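/- arXiv:2112.12392 — 5 statements merged into one kernel-verified Lean document; each statement's English description precedes it below -/
import Mathlib

section
/- Let ε > 0 and let Q ⊂ ℤ be an interval of cardinality |Q| ≥ M^{α−1+ε}, and for a dyadic integer N with M^θ ≤ N ≤ M set K_N(x) = (1/|Q|)·(μ_N∗1_Q)(x). Then there exist constants δ > 0 and C > 0 (depending only on α, ε, θ, φ, and not on M, N, Q) such that for every h ∈ ℤ: Σ_{x∈ℤ} |K_N(x+h) − K_N(x)|² ≤ (C/N^α)·(|h|/N^α)^δ. -/
open scoped BigOperators

/-- `μ_N(x) = Σ_{N ≤ m ≤ 2N, ⌊m^α⌋ = x} φ(m/N)/m`. -/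
noncomputable def mu (φ : ℝ → ℝ) (α : ℝ) (N : ℕ) (x : ℤ) : ℝ :=
  ∑ m ∈ Finset.Icc N (2 * N),
    if (⌊(m : ℝ) ^ α⌋ : ℤ) = x then φ ((m : ℝ) / (N : ℝ)) / (m : ℝ) else 0

/-- `K_N = μ_N ∗ (1_Q/|Q|)` for the interval `Q = [a,b] ∩ ℤ`. -/
noncomputable def KNQ (φ : ℝ → ℝ) (α : ℝ) (N : ℕ) (a b : ℤ) (x : ℤ) : ℝ :=
  (1 / ((Finset.Icc a b).card : ℝ)) * ∑ y ∈ Finset.Icc a b, mu φ α N (x - y)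

open MeasureTheory Set

/-- A compactly supported `C¹` function on the line is bounded and Lipschitz. -/
lemma exists_bound_lipschitz {f : ℝ → ℝ} (hf : ContDiff ℝ 1 f) (hs : HasCompactSupport f) :
    ∃ A : ℝ, 0 < A ∧ (∀ x, |f x| ≤ A) ∧ ∀ x y, |f x - f y| ≤ A * |x - y| := by
  obtain ⟨K, hK⟩ := hf.lipschitzWith_of_hasCompactSupport hs one_ne_zero
  obtain ⟨B, hB⟩ := hs.exists_bound_of_continuous hf.continuous
  have hB0 : 0 ≤ B := (norm_nonneg _).trans (hB 0)
  refine ⟨B + K + 1, by positivity, fun x => ?_, fun x y => ?_⟩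
  · have h := hB x
    rw [Real.norm_eq_abs] at h
    linarith [K.coe_nonneg]
  · have h := hK.dist_le_mul x y
    rw [Real.dist_eq, Real.dist_eq] at h
    nlinarith [abs_nonneg (x - y)]

/-- Mean value inequality on the whole line. -/
lemma abs_sub_le_of_hasDerivAt {f f' : ℝ → ℝ} {A : ℝ} (hf : ∀ x, HasDerivAt f (f' x) x)
    (hA : ∀ x, |f' x| ≤ A) (x y : ℝ) : |f y - f x| ≤ A * |y - x| :=
  Convex.norm_image_sub_le_of_norm_hasDerivWithin_le (s := univ)
    (fun z _ => (hf z).hasDerivWithinAt) (fun z _ => hA z) convex_univ (mem_univ x) (mem_univ y)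

/-- First order Taylor estimate for a function with Lipschitz derivative. -/
lemma abs_taylor_le {f f' : ℝ → ℝ} {A : ℝ} (hf : ∀ x, HasDerivAt f (f' x) x)
    (hA0 : 0 ≤ A) (hA : ∀ x y, |f' x - f' y| ≤ A * |x - y|) (x : ℝ) {d : ℝ} (hd : 0 ≤ d) :
    |f (x + d) - f x - f' x * d| ≤ A * d ^ 2 := by
  have h := Convex.norm_image_sub_le_of_norm_hasDerivWithin_le (s := Icc x (x + d))
    (f := fun y => f y - f' x * y) (f' := fun y => f' y - f' x) (C := A * d) (x := x) (y := x + d)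
    (fun z _ => by
      have h := (hf z).sub ((hasDerivAt_id z).const_mul (f' x))
      rw [mul_one] at h
      exact h.hasDerivWithinAt)
    (fun z hz => by
      refine (hA z x).trans (mul_le_mul_of_nonneg_left ?_ hA0)
      rw [abs_of_nonneg (by linarith [hz.1])]
      linarith [hz.2]) (convex_Icc _ _) ⟨le_rfl, by linarith⟩ ⟨by linarith, le_rfl⟩
  simp only [Real.norm_eq_abs, add_sub_cancel_left, abs_of_nonneg hd] at h
  calc _ = |f (x + d) - f' x * (x + d) - (f x - f' x * x)| := by ring_nf
    _ ≤ _ := h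
    _ = _ := by ring

/-- Second difference estimate for a function with Lipschitz derivative. -/
lemma abs_second_difference_le {f f' : ℝ → ℝ} {A : ℝ} (hf : ∀ x, HasDerivAt f (f' x) x)
    (hA : ∀ x y, |f' x - f' y| ≤ A * |x - y|) (x d e : ℝ) :
    |f (x + d + e) - f (x + d) - (f (x + e) - f x)| ≤ A * |e| * |d| := by
  have h := abs_sub_le_of_hasDerivAt (f := fun y => f (y + e) - f y)
    (f' := fun y => f' (y + e) - f' y) (A := A * |e|)
    (fun z => ((hf (z + e)).comp_add_const z e).sub (hf z))
    (fun z => by simpa using hA (z + e) z) x (x + d)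
  simpa using h

/-- The primitive of `g` starting at `1`. -/
noncomputable def primitiveOne (g : ℝ → ℝ) (t : ℝ) : ℝ := ∫ s in (1 : ℝ)..t, g s

section primitive

variable {g : ℝ → ℝ}

lemma hasDerivAt_primitiveOne (hg : Continuous g) (t : ℝ) :
    HasDerivAt (primitiveOne g) (g t) t :=
  intervalIntegral.integral_hasDerivAt_right (hg.intervalIntegrable _ _)
    (hg.stronglyMeasurableAtFilter _ _) hg.continuousAt

lemma contDiff_primitiveOne (hg : ContDiff ℝ 1 g) : ContDiff ℝ 2 (primitiveOne g) := by
  have hd := hasDerivAt_primitiveOne hg.continuous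
  have : deriv (primitiveOne g) = g := funext fun t => (hd t).deriv
  rw [show (2 : WithTop ℕ∞) = 1 + 1 by norm_num, contDiff_succ_iff_deriv]
  exact ⟨fun t => (hd t).differentiableAt, by simp, by rwa [this]⟩

lemma primitiveOne_of_le (h1 : ∀ t ≤ 1, g t = 0) {t : ℝ} (ht : t ≤ 1) :
    primitiveOne g t = 0 := by
  rw [primitiveOne, intervalIntegral.integral_congr (g := fun _ => (0 : ℝ))]
  · simp
  · intro s hs
    rw [uIcc_of_ge ht] at hs
    exact h1 s hs.2

lemma primitiveOne_of_ge (hg : Continuous g) (h2 : ∀ t, 2 ≤ t → g t = 0) {t : ℝ} (ht : 2 ≤ t) :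
    primitiveOne g t = primitiveOne g 2 := by
  rw [← sub_eq_zero, primitiveOne, primitiveOne, intervalIntegral.integral_interval_sub_left
    (hg.intervalIntegrable _ _) (hg.intervalIntegrable _ _),
    intervalIntegral.integral_congr (g := fun _ => (0 : ℝ))]
  · simp
  · intro s hs
    rw [uIcc_of_le ht] at hs
    exact h2 s hs.1

/-- Riemann sums of `g` at scale `N` are within `O(1/N)` of its primitive. -/
lemma abs_riemann_sum_sub_le (hg : Continuous g) (h1 : ∀ t ≤ 1, g t = 0)
    (h2 : ∀ t, 2 ≤ t → g t = 0) {A : ℝ} (hA0 : 0 ≤ A)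
    (hA : ∀ x y, |g x - g y| ≤ A * |x - y|) {N : ℕ} (hN : 0 < N) (n : ℕ) :
    |∑ m ∈ Finset.range n, g ((m : ℝ) / N) / N - primitiveOne g ((n : ℝ) / N)|
      ≤ A * (min n (2 * N) : ℕ) / (N : ℝ) ^ 2 := by
  have hN' : (0 : ℝ) < N := by exact_mod_cast hN
  induction n with
  | zero => simp [primitiveOne_of_le h1 zero_le_one]
  | succ n ih =>
    rw [Finset.sum_range_succ]
    rcases lt_or_ge n (2 * N) with h | h
    · have ht := abs_taylor_le (hasDerivAt_primitiveOne hg) hA0 hA ((n : ℝ) / N)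
        (d := 1 / N) (by positivity)
      rw [min_eq_left (by omega)] at ih ⊢
      have e : ((n + 1 : ℕ) : ℝ) / N = (n : ℝ) / N + 1 / N := by push_cast; ring
      rw [e]
      calc _ = |(∑ m ∈ Finset.range n, g ((m : ℝ) / N) / N - primitiveOne g ((n : ℝ) / N))
            - (primitiveOne g ((n : ℝ) / N + 1 / N) - primitiveOne g ((n : ℝ) / N)
              - g ((n : ℝ) / N) * (1 / N))| := by congr 1; ring
        _ ≤ _ := abs_sub _ _
        _ ≤ _ := add_le_add ih ht
        _ = _ := by push_cast; ring
    · have hn : (2 : ℝ) ≤ (n : ℝ) / N := by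
        rw [le_div_iff₀ hN']; exact_mod_cast h
      have hn' : (2 : ℝ) ≤ ((n + 1 : ℕ) : ℝ) / N := by
        rw [le_div_iff₀ hN']; push_cast; rw [le_div_iff₀ hN'] at hn; linarith
      rw [min_eq_right (by omega)] at ih ⊢
      rw [h2 _ hn, primitiveOne_of_ge hg h2 hn', zero_div, add_zero]
      rwa [primitiveOne_of_ge hg h2 hn] at ih

/-- The summatory function of `g(m/N)/N` over `m < T` is within `O(1/N)` of the primitive. -/
lemma abs_sum_lt_sub_le (hg : Continuous g) (h1 : ∀ t ≤ 1, g t = 0)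
    (h2 : ∀ t, 2 ≤ t → g t = 0) {A : ℝ} (hA0 : 0 ≤ A) (hA' : ∀ x, |g x| ≤ A)
    (hA : ∀ x y, |g x - g y| ≤ A * |x - y|) {N : ℕ} (hN : 0 < N) {T : ℝ} (hT : 0 ≤ T) :
    |∑ m ∈ Finset.Icc N (2 * N), (if (m : ℝ) < T then g ((m : ℝ) / N) / N else 0)
        - primitiveOne g (T / N)| ≤ 3 * A / N := by
  have hN' : (0 : ℝ) < N := by exact_mod_cast hN
  have hsum : ∑ m ∈ Finset.Icc N (2 * N), (if (m : ℝ) < T then g ((m : ℝ) / N) / N else 0)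
      = ∑ m ∈ Finset.range ⌈T⌉₊, g ((m : ℝ) / N) / N := by
    simp_rw [← Nat.lt_ceil]
    rw [← Finset.sum_filter]
    refine Finset.sum_subset (fun m hm => ?_) (fun m hm hm' => ?_)
    · simp only [Finset.mem_filter] at hm
      exact Finset.mem_range.2 hm.2
    · simp only [Finset.mem_filter, Finset.mem_Icc, Finset.mem_range] at hm hm'
      rcases lt_or_ge m N with h | h
      · rw [h1, zero_div]
        rw [div_le_one hN']; exact_mod_cast h.le
      · rw [h2, zero_div]
        rw [le_div_iff₀ hN']
        have : 2 * N ≤ m := by omega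
        exact_mod_cast this
  have e1 := abs_riemann_sum_sub_le hg h1 h2 hA0 hA hN ⌈T⌉₊
  have e2 := abs_sub_le_of_hasDerivAt (hasDerivAt_primitiveOne hg) hA' (T / N) ((⌈T⌉₊ : ℝ) / N)
  have e3 : |(⌈T⌉₊ : ℝ) / N - T / N| ≤ 1 / N := by
    rw [← sub_div, abs_of_nonneg (div_nonneg (by linarith [Nat.le_ceil T]) hN'.le)]
    gcongr
    linarith [Nat.ceil_lt_add_one hT]
  have e4 : A * (min ⌈T⌉₊ (2 * N) : ℕ) / (N : ℝ) ^ 2 ≤ 2 * A / N := by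
    have : ((min ⌈T⌉₊ (2 * N) : ℕ) : ℝ) ≤ 2 * N := by exact_mod_cast min_le_right _ _
    calc _ ≤ A * (2 * N) / (N : ℝ) ^ 2 := by gcongr
      _ = _ := by field_simp
  rw [hsum]
  calc _ ≤ _ := abs_sub_le _ (primitiveOne g ((⌈T⌉₊ : ℝ) / N)) _
    _ ≤ 2 * A / N + A * (1 / N) :=
      add_le_add (e1.trans e4) (e2.trans (mul_le_mul_of_nonneg_left e3 hA0))
    _ = _ := by ring

/-- The function `u ↦ Φ(u₊ ^ β)` where `Φ` is the primitive of `g`. -/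
noncomputable def powPrimitive (g : ℝ → ℝ) (β u : ℝ) : ℝ := primitiveOne g (max u 0 ^ β)

lemma powPrimitive_of_lt (h1 : ∀ t ≤ 1, g t = 0) {β u : ℝ} (hβ : 0 ≤ β) (hu : u < 1) :
    powPrimitive g β u = 0 :=
  primitiveOne_of_le h1
    (Real.rpow_le_one (le_max_right _ _) (max_le hu.le zero_le_one) hβ)

lemma powPrimitive_of_gt (hg : Continuous g) (h2 : ∀ t, 2 ≤ t → g t = 0) {β u : ℝ} (hβ : 0 < β)
    (hu : 2 ^ β⁻¹ < u) : powPrimitive g β u = primitiveOne g 2 := by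
  refine primitiveOne_of_ge hg h2 ?_
  rw [← Real.rpow_inv_rpow (zero_le_two) hβ.ne']
  exact Real.rpow_le_rpow (by positivity) (hu.le.trans (le_max_left _ _)) hβ.le

lemma contDiff_powPrimitive (hg : ContDiff ℝ 1 g) (h1 : ∀ t ≤ 1, g t = 0) {β : ℝ}
    (hβ : 0 ≤ β) : ContDiff ℝ 2 (powPrimitive g β) := by
  rw [contDiff_iff_contDiffAt]
  intro u
  rcases lt_or_ge u 1 with hu | hu
  · refine (contDiffAt_const (c := (0 : ℝ))).congr_of_eventuallyEq ?_
    filter_upwards [Iio_mem_nhds hu] with v hv using powPrimitive_of_lt h1 hβ hv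
  · have hu0 : 0 < u := by linarith
    refine ((contDiff_primitiveOne hg).contDiffAt.comp u
      (Real.contDiffAt_rpow_const_of_ne (p := β) hu0.ne')).congr_of_eventuallyEq ?_
    filter_upwards [Ioi_mem_nhds hu0] with v hv
    simp [powPrimitive, max_eq_left (le_of_lt (mem_Ioi.1 hv))]

lemma hasCompactSupport_deriv_powPrimitive (hg : Continuous g) (h1 : ∀ t ≤ 1, g t = 0)
    (h2 : ∀ t, 2 ≤ t → g t = 0) {β : ℝ} (hβ : 0 < β) :
    HasCompactSupport (deriv (powPrimitive g β)) := by
  refine HasCompactSupport.intro (isCompact_Icc (a := (1 : ℝ)) (b := 2 ^ β⁻¹)) fun u hu => ?_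
  rw [mem_Icc, not_and_or, not_le, not_le] at hu
  rcases hu with hu | hu
  · have : powPrimitive g β =ᶠ[nhds u] fun _ => 0 := by
      filter_upwards [Iio_mem_nhds hu] with v hv using powPrimitive_of_lt h1 hβ.le hv
    rw [this.deriv_eq, deriv_const]
  · have : powPrimitive g β =ᶠ[nhds u] fun _ => primitiveOne g 2 := by
      filter_upwards [Ioi_mem_nhds hu] with v hv using powPrimitive_of_gt hg h2 hβ hv
    rw [this.deriv_eq, deriv_const]

end primitive

section kernel

/-- The summatory function of `mu`. -/
noncomputable def muSum (φ : ℝ → ℝ) (α : ℝ) (N : ℕ) (z : ℤ) : ℝ :=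
  ∑ m ∈ Finset.Icc N (2 * N),
    if (⌊(m : ℝ) ^ α⌋ : ℤ) ≤ z then φ ((m : ℝ) / (N : ℝ)) / (m : ℝ) else 0

lemma sum_mu_eq (φ : ℝ → ℝ) (α : ℝ) (N : ℕ) {a b : ℤ} (hab : a ≤ b) (x : ℤ) :
    ∑ y ∈ Finset.Icc a b, mu φ α N (x - y)
      = muSum φ α N (x - a) - muSum φ α N (x - b - 1) := by
  simp only [mu, muSum]
  rw [Finset.sum_comm, ← Finset.sum_sub_distrib]
  refine Finset.sum_congr rfl fun m _ => ?_
  have e : ∀ y : ℤ, ((⌊(m : ℝ) ^ α⌋ : ℤ) = x - y) ↔ (x - ⌊(m : ℝ) ^ α⌋ = y) := fun y => by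
    constructor <;> intro h <;> omega
  simp_rw [e]
  rw [Finset.sum_ite_eq]
  simp only [Finset.mem_Icc]
  split_ifs <;> first | omega | simp

lemma abs_muSum_sub_le {φ g : ℝ → ℝ} (hφ : ∀ t, g t = φ t / t) (hg : Continuous g)
    (h1 : ∀ t ≤ 1, g t = 0) (h2 : ∀ t, 2 ≤ t → g t = 0) {A : ℝ} (hA0 : 0 ≤ A)
    (hA' : ∀ x, |g x| ≤ A) (hA : ∀ x y, |g x - g y| ≤ A * |x - y|) {α : ℝ} (hα : 0 < α)
    {N : ℕ} (hN : 0 < N) (z : ℤ) :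
    |muSum φ α N z - powPrimitive g α⁻¹ (((z : ℝ) + 1) / (N : ℝ) ^ α)| ≤ 3 * A / N := by
  have hN' : (0 : ℝ) < N := by exact_mod_cast hN
  have e1 : powPrimitive g α⁻¹ (((z : ℝ) + 1) / (N : ℝ) ^ α)
      = primitiveOne g (max ((z : ℝ) + 1) 0 ^ α⁻¹ / N) := by
    have hp : (0 : ℝ) < (N : ℝ) ^ α := by positivity
    rw [powPrimitive]
    congr 1
    rw [show (0 : ℝ) = 0 / (N : ℝ) ^ α by simp, max_div_div_right hp.le, zero_div,
      Real.div_rpow (le_max_right _ _) hp.le, Real.rpow_rpow_inv hN'.le hα.ne']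
  have e2 : muSum φ α N z = ∑ m ∈ Finset.Icc N (2 * N),
      if (m : ℝ) < max ((z : ℝ) + 1) 0 ^ α⁻¹ then g ((m : ℝ) / N) / N else 0 := by
    refine Finset.sum_congr rfl fun m hm => ?_
    have hm0 : (0 : ℝ) < m := by
      have := (Finset.mem_Icc.1 hm).1
      exact_mod_cast (by omega : 0 < m)
    have hiff : (⌊(m : ℝ) ^ α⌋ : ℤ) ≤ z ↔ (m : ℝ) < max ((z : ℝ) + 1) 0 ^ α⁻¹ := by
      rw [Int.floor_le_iff, Real.lt_rpow_inv_iff_of_pos hm0.le (le_max_right _ _) hα, lt_max_iff,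
        or_iff_left (not_lt.2 (by positivity))]
    rw [hφ]
    simp only [hiff]
    congr 1
    field_simp
  rw [e1, e2]
  exact abs_sum_lt_sub_le hg h1 h2 hA0 hA' hA hN (by positivity)

/-- A pointwise majorant of `|KNQ|` that is summed explicitly. -/
lemma exists_majorant_KNQ (φ : ℝ → ℝ) (α : ℝ) (N : ℕ) {a b : ℤ} (hab : a ≤ b) :
    ∃ k : ℤ → ℝ, (∀ x, |KNQ φ α N a b x| ≤ k x) ∧
      HasSum k (∑ m ∈ Finset.Icc N (2 * N), |φ ((m : ℝ) / N) / m|) := by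
  set W := ∑ m ∈ Finset.Icc N (2 * N), |φ ((m : ℝ) / N) / m| with hW
  let u : ℤ → ℝ := fun x => ∑ m ∈ Finset.Icc N (2 * N),
    if x = (⌊(m : ℝ) ^ α⌋ : ℤ) then |φ ((m : ℝ) / N) / m| else 0
  have hu : HasSum u W := hasSum_sum fun m _ => hasSum_ite_eq _ _
  have hmu : ∀ x, |mu φ α N x| ≤ u x := fun x => by
    refine (Finset.abs_sum_le_sum_abs _ _).trans (Finset.sum_le_sum fun m _ => ?_)
    by_cases h : (⌊(m : ℝ) ^ α⌋ : ℤ) = x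
    · simp [h]
    · simp [h, Ne.symm h]
  have hL : (0 : ℝ) < ((Finset.Icc a b).card : ℝ) := by
    exact_mod_cast Finset.card_pos.2 (Finset.nonempty_Icc.2 hab)
  refine ⟨fun x => (1 / ((Finset.Icc a b).card : ℝ)) * ∑ y ∈ Finset.Icc a b, u (x - y),
    fun x => ?_, ?_⟩
  · rw [KNQ, abs_mul, abs_of_pos (one_div_pos.2 hL)]
    exact mul_le_mul_of_nonneg_left
      ((Finset.abs_sum_le_sum_abs (fun y => mu φ α N (x - y)) _).trans
        (Finset.sum_le_sum fun y _ => hmu (x - y))) (one_div_pos.2 hL).le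
  · have hy : ∀ y : ℤ, HasSum (fun x => u (x - y)) W := fun y =>
      (Equiv.hasSum_iff (f := u) (Equiv.subRight y)).2 hu
    have h : HasSum (fun x => ∑ y ∈ Finset.Icc a b, u (x - y)) (∑ y ∈ Finset.Icc a b, W) :=
      hasSum_sum fun y _ => hy y
    have h' := h.mul_left (1 / ((Finset.Icc a b).card : ℝ))
    rwa [Finset.sum_const, nsmul_eq_mul, ← mul_assoc, one_div_mul_cancel hL.ne', one_mul] at h'

/-- An `ℓ²` bound for differences from an `ℓ∞` bound and an `ℓ¹` majorant. -/
lemma tsum_sq_sub_le {f k : ℤ → ℝ} {S W : ℝ} {h : ℤ} (hS0 : 0 ≤ S)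
    (hS : ∀ x, |f (x + h) - f x| ≤ S) (hk : ∀ x, |f x| ≤ k x) (hW : HasSum k W) :
    ∑' x, |f (x + h) - f x| ^ 2 ≤ S * (2 * W) := by
  have hs : HasSum (fun x => S * (k (x + h) + k x)) (S * (2 * W)) := by
    have := (((Equiv.addRight h).hasSum_iff.2 hW).add hW).mul_left S
    rwa [← two_mul] at this
  have hle : ∀ x, |f (x + h) - f x| ^ 2 ≤ S * (k (x + h) + k x) := fun x => by
    rw [sq]
    exact mul_le_mul (hS x) ((abs_sub _ _).trans (add_le_add (hk _) (hk _)))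
      (abs_nonneg _) hS0
  exact hasSum_le hle (Summable.of_nonneg_of_le (fun x => by positivity) hle hs.summable).hasSum hs

/-- The pointwise size of `KNQ` and of its differences. -/
lemma exists_KNQ_bounds {φ : ℝ → ℝ} (hφ : ContDiff ℝ 1 φ)
    (hsupp : Function.support φ ⊆ Set.Ioo 1 2) {α : ℝ} (hα : 0 < α) :
    ∃ A : ℝ, 0 < A ∧ ∀ (N : ℕ) (a b : ℤ), 0 < N → a ≤ b →
      (∀ x h : ℤ, |KNQ φ α N a b (x + h) - KNQ φ α N a b x| ≤
        A * (|(h : ℝ)| / (N : ℝ) ^ α / (N : ℝ) ^ α + 1 / (((Finset.Icc a b).card : ℝ) * N))) ∧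
      (∀ x : ℤ, |KNQ φ α N a b x| ≤
        A * (1 / (N : ℝ) ^ α + 1 / (((Finset.Icc a b).card : ℝ) * N))) ∧
      ∑ m ∈ Finset.Icc N (2 * N), |φ ((m : ℝ) / N) / m| ≤ A := by
  have hz : ∀ t, t ∉ Set.Ioo (1 : ℝ) 2 → φ t = 0 := fun t ht => by
    by_contra h
    exact ht (hsupp h)
  set g : ℝ → ℝ := fun t => φ t / t with hgdef
  have h1 : ∀ t ≤ 1, g t = 0 := fun t ht => by
    simp [hgdef, hz t (fun h => by linarith [h.1])]
  have h2 : ∀ t, 2 ≤ t → g t = 0 := fun t ht => by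
    simp [hgdef, hz t (fun h => by linarith [h.2])]
  have hg : ContDiff ℝ 1 g := by
    rw [contDiff_iff_contDiffAt]
    intro u
    rcases lt_or_ge u 1 with hu | hu
    · refine (contDiffAt_const (c := (0 : ℝ))).congr_of_eventuallyEq ?_
      filter_upwards [Iio_mem_nhds hu] with v hv using h1 v (le_of_lt hv)
    · exact hφ.contDiffAt.div contDiffAt_id (by simp; linarith)
  have hgs : HasCompactSupport g :=
    HasCompactSupport.intro (isCompact_Icc (a := (1 : ℝ)) (b := 2)) fun u hu => by
      rw [mem_Icc, not_and_or, not_le, not_le] at hu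
      exact hu.elim (fun h => h1 u h.le) (fun h => h2 u h.le)
  obtain ⟨A, hA0, hA', hA⟩ := exists_bound_lipschitz hg hgs
  have hβ : 0 < α⁻¹ := inv_pos.2 hα
  have hH := contDiff_powPrimitive hg h1 hβ.le
  have hHd : ∀ u, HasDerivAt (powPrimitive g α⁻¹) (deriv (powPrimitive g α⁻¹) u) u := fun u =>
    (hH.differentiable (by simp) u).hasDerivAt
  have hH' : ContDiff ℝ 1 (deriv (powPrimitive g α⁻¹)) :=
    ((contDiff_succ_iff_deriv (n := 1)).1 (by simpa [one_add_one_eq_two] using hH)).2.2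
  obtain ⟨B, hB0, hB', hB⟩ := exists_bound_lipschitz hH'
    (hasCompactSupport_deriv_powPrimitive hg.continuous h1 h2 hβ)
  refine ⟨B + 12 * A, by positivity, fun N a b hN hab => ?_⟩
  have hN' : (0 : ℝ) < N := by exact_mod_cast hN
  set P : ℝ := (N : ℝ) ^ α with hP
  have hP0 : 0 < P := by positivity
  set L : ℝ := ((Finset.Icc a b).card : ℝ) with hL
  have hL0 : 0 < L := by
    rw [hL]; exact_mod_cast Finset.card_pos.2 (Finset.nonempty_Icc.2 hab)
  have hLe : L = b - a + 1 := by
    rw [hL, Int.card_Icc]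
    have : (((b + 1 - a).toNat : ℤ) : ℝ) = ((b + 1 - a : ℤ) : ℝ) := by
      rw [Int.toNat_of_nonneg (by omega)]
    push_cast at this
    linarith
  set H := powPrimitive g α⁻¹
  have hG : ∀ z : ℤ, |muSum φ α N z - H (((z : ℝ) + 1) / P)| ≤ 3 * A / N :=
    abs_muSum_sub_le (fun _ => rfl) hg.continuous h1 h2 hA0.le hA' hA hα hN
  have hK : ∀ x : ℤ, KNQ φ α N a b x
      = 1 / L * (muSum φ α N (x - a) - muSum φ α N (x - b - 1)) := fun x => by
    rw [KNQ, sum_mu_eq φ α N hab]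
  have harg : ∀ x : ℤ, (((x - a : ℤ) : ℝ) + 1) / P
      = (((x - b - 1 : ℤ) : ℝ) + 1) / P + L / P := fun x => by
    rw [hLe]; push_cast; ring
  refine ⟨fun x h => ?_, fun x => ?_, ?_⟩
  · set v := (((x - b - 1 : ℤ) : ℝ) + 1) / P with hv
    have hv' : (((x + h - b - 1 : ℤ) : ℝ) + 1) / P = v + h / P := by
      rw [hv]; push_cast; ring
    have hu' : (((x + h - a : ℤ) : ℝ) + 1) / P = v + L / P + h / P := by
      rw [harg, hv']; ring
    have b1 := hG (x + h - a)
    have b2 := hG (x + h - b - 1)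
    have b3 := hG (x - a)
    have b4 := hG (x - b - 1)
    rw [hu'] at b1
    rw [hv'] at b2
    rw [harg, ← hv] at b3
    have b5 := abs_second_difference_le hHd hB v (L / P) (h / P)
    have key : |(muSum φ α N (x + h - a) - muSum φ α N (x + h - b - 1))
        - (muSum φ α N (x - a) - muSum φ α N (x - b - 1))|
        ≤ B * |(h : ℝ) / P| * |L / P| + 12 * A / N := by
      have e : 12 * A / N = 4 * (3 * A / N) := by ring
      rw [e]
      rw [abs_le] at b1 b2 b3 b4 b5 ⊢
      constructor <;> linarith [b1.1, b1.2, b2.1, b2.2, b3.1, b3.2, b4.1, b4.2, b5.1, b5.2]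
    rw [hK, hK, ← mul_sub, abs_mul, abs_of_pos (by positivity : 0 < 1 / L)]
    rw [abs_div, abs_div, abs_of_pos hP0, abs_of_pos hL0] at key
    calc _ ≤ 1 / L * (B * (|(h : ℝ)| / P) * (L / P) + 12 * A / N) := by gcongr
      _ = B * (|(h : ℝ)| / P / P) + 12 * A * (1 / (L * N)) := by field_simp
      _ ≤ (B + 12 * A) * (|(h : ℝ)| / P / P) + (B + 12 * A) * (1 / (L * N)) := by
        gcongr <;> linarith
      _ = _ := by ring
  · have b3 := hG (x - a)
    have b4 := hG (x - b - 1)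
    rw [harg] at b3
    set v := (((x - b - 1 : ℤ) : ℝ) + 1) / P with hv
    have b5 := abs_sub_le_of_hasDerivAt hHd hB' v (v + L / P)
    rw [add_sub_cancel_left, abs_of_pos (by positivity : 0 < L / P)] at b5
    have key : |muSum φ α N (x - a) - muSum φ α N (x - b - 1)| ≤ B * (L / P) + 12 * A / N := by
      have e : 12 * A / N = 4 * (3 * A / N) := by ring
      have : 0 ≤ 3 * A / N := by positivity
      rw [e]
      rw [abs_le] at b3 b4 b5 ⊢
      constructor <;> linarith [b3.1, b3.2, b4.1, b4.2, b5.1, b5.2]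
    rw [hK, abs_mul, abs_of_pos (by positivity : 0 < 1 / L)]
    calc _ ≤ 1 / L * (B * (L / P) + 12 * A / N) := by gcongr
      _ = B * (1 / P) + 12 * A * (1 / (L * N)) := by field_simp
      _ ≤ (B + 12 * A) * (1 / P) + (B + 12 * A) * (1 / (L * N)) := by
        gcongr <;> linarith
      _ = _ := by ring
  · have hN1 : (1 : ℝ) ≤ N := by exact_mod_cast hN
    calc _ ≤ ∑ m ∈ Finset.Icc N (2 * N), A / N := by
          refine Finset.sum_le_sum fun m hm => ?_
          have hm0 : (0 : ℝ) < m := by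
            have := (Finset.mem_Icc.1 hm).1
            exact_mod_cast (by omega : 0 < m)
          have e : φ ((m : ℝ) / N) / m = g ((m : ℝ) / N) / N := by
            simp only [hgdef]; field_simp
          rw [e, abs_div, abs_of_pos hN']
          gcongr
          exact hA' _
      _ = (N + 1) * (A / N) := by
          rw [Finset.sum_const, nsmul_eq_mul, Nat.card_Icc,
            show 2 * N + 1 - N = N + 1 by omega]
          push_cast; ring
      _ ≤ (2 * N) * (A / N) := by gcongr; linarith
      _ = 2 * A := by field_simp
      _ ≤ _ := by linarith

end kernel

/-- `ℓ²` Hölder regularity of `K_N = μ_N ∗ (1_Q/|Q|)` for intervals `Q` of length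
`≥ M^{α−1+ε}`: `Σ_x |K_N(x+h) − K_N(x)|² ≤ (C/N^α)(|h|/N^α)^δ`. -/
theorem l2_holder_regularity (α : ℝ) (hα₁ : 1 < α) (hα₂ : α ≤ 1 + 1 / 1000)
    (ε : ℝ) (hε : 0 < ε) :
    ∃ θ₀ : ℝ, 0 < θ₀ ∧ θ₀ < 1 ∧
      ∀ θ : ℝ, θ₀ < θ → θ < 1 →
      ∀ φ : ℝ → ℝ, ContDiff ℝ (⊤ : ℕ∞) φ → Function.support φ ⊆ Set.Ioo 1 2 →
      ∃ δ C : ℝ, 0 < δ ∧ 0 < C ∧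
      ∀ (KM k : ℕ) (a b : ℤ), a ≤ b →
        ((2 : ℝ) ^ KM) ^ (α - 1 + ε) ≤ ((Finset.Icc a b).card : ℝ) →
        ((2 : ℝ) ^ KM) ^ θ ≤ (2 : ℝ) ^ k → (2 : ℝ) ^ k ≤ (2 : ℝ) ^ KM →
        ∀ h : ℤ,
          ∑' x : ℤ, |KNQ φ α (2 ^ k) a b (x + h) - KNQ φ α (2 ^ k) a b x| ^ 2 ≤
            C / ((2 : ℝ) ^ k) ^ α * (((|h| : ℤ) : ℝ) / ((2 : ℝ) ^ k) ^ α) ^ δ := by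
  refine ⟨1 / 2, by norm_num, by norm_num, fun θ _ _ φ hφ hsupp => ?_⟩
  have hα0 : 0 < α := by linarith
  obtain ⟨A, hA0, hA⟩ := exists_KNQ_bounds (hφ.of_le (by exact_mod_cast le_top)) hsupp hα0
  have hδ0 : 0 < min 1 (ε / α) := lt_min one_pos (by positivity)
  refine ⟨min 1 (ε / α), 8 * A ^ 2, hδ0, by positivity, fun KM k a b hab hQ _ hkM h => ?_⟩
  set δ := min 1 (ε / α)
  obtain ⟨hdiff, hsize, hmass⟩ := hA (2 ^ k) a b (by positivity) hab
  obtain ⟨κ, hκ, hκsum⟩ := exists_majorant_KNQ φ α (2 ^ k) hab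
  rcases eq_or_ne h 0 with rfl | hh
  · simp [Real.zero_rpow hδ0.ne']
  push_cast at hdiff hsize
  rw [Int.cast_abs]
  set N : ℝ := (2 : ℝ) ^ k
  have hN1 : 1 ≤ N := one_le_pow₀ one_le_two
  have hN0 : 0 < N := by linarith
  set P : ℝ := N ^ α with hP
  have hP0 : 0 < P := by positivity
  set L : ℝ := ((Finset.Icc a b).card : ℝ)
  have hLN : P * N ^ ε ≤ L * N := by
    calc P * N ^ ε = N ^ (α - 1 + ε) * N := by
          rw [hP, ← Real.rpow_add hN0, ← Real.rpow_add_one hN0.ne']; ring_nf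
      _ ≤ ((2 : ℝ) ^ KM) ^ (α - 1 + ε) * N := by gcongr
      _ ≤ L * N := by gcongr
  have hNε : 1 ≤ N ^ ε := Real.one_le_rpow hN1 hε.le
  set r : ℝ := |(h : ℝ)| / P
  have hh1 : (1 : ℝ) ≤ |(h : ℝ)| := by exact_mod_cast Int.one_le_abs hh
  have hr0 : 0 < r := by positivity
  have herr : 1 / (L * N) ≤ 1 / P * (1 / N ^ ε) := by
    rw [one_div_mul_one_div]
    exact one_div_le_one_div_of_le (by positivity) hLN
  have herr' : 1 / N ^ ε ≤ r ^ δ := by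
    calc 1 / N ^ ε ≤ 1 / N ^ (α * δ) := by
          refine one_div_le_one_div_of_le (by positivity) (Real.rpow_le_rpow_of_exponent_le hN1 ?_)
          calc α * δ ≤ α * (ε / α) := by gcongr; exact min_le_right _ _
            _ = ε := by field_simp
      _ = (1 / P) ^ δ := by
          rw [Real.div_rpow zero_le_one hP0.le, Real.one_rpow, hP, ← Real.rpow_mul hN0.le]
      _ ≤ r ^ δ := by gcongr; exact div_le_div_of_nonneg_right hh1 hP0.le
  have hS : ∀ x, |KNQ φ α (2 ^ k) a b (x + h) - KNQ φ α (2 ^ k) a b x| ≤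
      4 * A * (1 / P * r ^ δ) := fun x => by
    rcases le_total r 1 with hr | hr
    · have hrδ : r ≤ r ^ δ := by
        simpa using Real.rpow_le_rpow_of_exponent_ge hr0 hr (min_le_left 1 (ε / α))
      calc _ ≤ A * (r / P + 1 / (L * N)) := hdiff x h
        _ ≤ A * (r ^ δ / P + 1 / P * r ^ δ) := by
          gcongr
          exact herr.trans (by gcongr)
        _ = 2 * A * (1 / P * r ^ δ) := by ring
        _ ≤ _ := by gcongr; norm_num
    · have hrδ : 1 ≤ r ^ δ := Real.one_le_rpow hr hδ0.le
      have hb : ∀ y, |KNQ φ α (2 ^ k) a b y| ≤ 2 * A * (1 / P) := fun y => by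
        calc _ ≤ A * (1 / P + 1 / (L * N)) := hsize y
          _ ≤ A * (1 / P + 1 / P * 1) := by
            gcongr
            refine herr.trans (by gcongr; exact (div_le_one (by positivity)).2 hNε)
          _ = _ := by ring
      calc _ ≤ _ := abs_sub _ _
        _ ≤ 2 * A * (1 / P) + 2 * A * (1 / P) := add_le_add (hb _) (hb _)
        _ = 4 * A * (1 / P * 1) := by ring
        _ ≤ _ := by gcongr
  calc _ ≤ _ := tsum_sq_sub_le (by positivity) hS hκ hκsum
    _ ≤ 4 * A * (1 / P * r ^ δ) * (2 * A) := by gcongr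
    _ = _ := by ring
end

section
/- Let λ₀ > 0 and M = 2^K be a dyadic integer. For each dyadic N ≤ M let a_N ≥ 0 and β_N be reals with 0 ≤ β_N ≤ λ₀. For j ≥ 1 define, whenever the maximum exists, N_j = max{2^k ≤ M : Σ_{N ≤ 2^k, N dyadic} β_N ≤ j·λ₀}. Then: (i) the N_j form a strictly increasing sequence of dyadic integers (as long as N_j < M); (ii) if max_{B ≤ M, B dyadic} |Σ_{N ≤ B} a_N − Σ_{N ≤ B} β_N| ≥ 4λ₀, then max_j |Σ_{N ≤ N_j} a_N − Σ_{N ≤ N_j} β_N| ≥ λ₀. -/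
open scoped BigOperators

attribute [local instance] Classical.propDecidable

/-- The exponent of `N_j = max{2^k ≤ 2^K : Σ_{N ≤ 2^k, N dyadic} β_N ≤ j·λ₀}`, where the
dyadic integer `2^l` carries the weight `β l`. -/
noncomputable def Nj (β : ℕ → ℝ) (lam₀ : ℝ) (K j : ℕ) : ℕ :=
  Nat.findGreatest (fun k => ∑ l ∈ Finset.range (k + 1), β l ≤ j * lam₀) K

lemma sum_range_Nj_le {β : ℕ → ℝ} {lam₀ : ℝ} {K j : ℕ} (h₀ : β 0 ≤ j * lam₀) :
    ∑ l ∈ Finset.range (Nj β lam₀ K j + 1), β l ≤ j * lam₀ :=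
  Nat.findGreatest_spec (P := fun k => ∑ l ∈ Finset.range (k + 1), β l ≤ j * lam₀)
    (Nat.zero_le K) (by simpa using h₀)

lemma le_Nj {β : ℕ → ℝ} {lam₀ : ℝ} {K j k : ℕ} (hk : k ≤ K)
    (h : ∑ l ∈ Finset.range (k + 1), β l ≤ j * lam₀) : k ≤ Nj β lam₀ K j :=
  Nat.le_findGreatest (P := fun k => ∑ l ∈ Finset.range (k + 1), β l ≤ j * lam₀) hk h

lemma sum_range_succ_mono {f : ℕ → ℝ} (hf : ∀ k, 0 ≤ f k) {m n : ℕ} (h : m ≤ n) :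
    ∑ k ∈ Finset.range (m + 1), f k ≤ ∑ k ∈ Finset.range (n + 1), f k :=
  Finset.sum_le_sum_of_subset_of_nonneg (Finset.range_mono (by omega)) fun k _ _ => hf k

/-- Sparse maximal principle: (i) the `N_j` are strictly increasing (as long as `N_j < M`);
(ii) if the full dyadic maximal function of `Σ (a_N − β_N)` is `≥ 4λ₀` then already the
maximal function along the sparse sequence `{N_j}` is `≥ λ₀`. -/
theorem sparse_maximal (lam₀ : ℝ) (hlam₀ : 0 < lam₀) (K : ℕ) (a β : ℕ → ℝ)
    (ha : ∀ k, 0 ≤ a k) (hβ₀ : ∀ k, 0 ≤ β k) (hβ₁ : ∀ k, β k ≤ lam₀) :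
    (∀ j : ℕ, 1 ≤ j → Nj β lam₀ K j < K → Nj β lam₀ K j < Nj β lam₀ K (j + 1)) ∧
    ((∃ b : ℕ, b ≤ K ∧
        4 * lam₀ ≤
          |∑ k ∈ Finset.range (b + 1), a k - ∑ k ∈ Finset.range (b + 1), β k|) →
      ∃ j : ℕ, 1 ≤ j ∧
        lam₀ ≤
          |∑ k ∈ Finset.range (Nj β lam₀ K j + 1), a k -
            ∑ k ∈ Finset.range (Nj β lam₀ K j + 1), β k|) := by
  have h_zero : ∀ j : ℕ, 1 ≤ j → β 0 ≤ j * lam₀ := fun j hj => by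
    have hj' : (1 : ℝ) ≤ j := by exact_mod_cast hj
    nlinarith [hβ₁ 0]
  refine ⟨fun j hj hK => le_Nj hK ?_, ?_⟩
  · rw [Finset.sum_range_succ]
    push_cast
    linarith [sum_range_Nj_le (K := K) (h_zero j hj), hβ₁ (Nj β lam₀ K j + 1)]
  rintro ⟨b, hb, h_big⟩
  by_contra! h_small
  have h_ex : ∃ i : ℕ, ∑ k ∈ Finset.range (b + 1), β k ≤ ((i + 1 : ℕ) : ℝ) * lam₀ := by
    obtain ⟨i, hi⟩ := exists_nat_ge ((∑ k ∈ Finset.range (b + 1), β k) / lam₀)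
    refine ⟨i, ?_⟩
    rw [div_le_iff₀ hlam₀] at hi
    push_cast
    linarith
  obtain ⟨i, hi, h_min⟩ : ∃ i : ℕ, ∑ k ∈ Finset.range (b + 1), β k ≤ ((i + 1 : ℕ) : ℝ) * lam₀ ∧
      ∀ m < i, ¬ ∑ k ∈ Finset.range (b + 1), β k ≤ ((m + 1 : ℕ) : ℝ) * lam₀ :=
    ⟨Nat.find h_ex, Nat.find_spec h_ex, fun _ => Nat.find_min h_ex⟩
  have h_upper := sum_range_succ_mono ha (le_Nj hb hi)
  have h_next := abs_lt.1 (h_small (i + 1) (by omega))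
  have h_sum := sum_range_Nj_le (K := K) (h_zero (i + 1) (by omega))
  have ha_nonneg : 0 ≤ ∑ k ∈ Finset.range (b + 1), a k := Finset.sum_nonneg fun k _ => ha k
  have hβ_nonneg : 0 ≤ ∑ k ∈ Finset.range (b + 1), β k := Finset.sum_nonneg fun k _ => hβ₀ k
  refine absurd h_big (not_le.2 (abs_lt.2 ?_))
  cases i with
  | zero =>
    push_cast at hi h_sum
    constructor <;> linarith
  | succ i =>
    have h_lt := not_le.1 (h_min i (by omega))
    have h_prev := abs_lt.1 (h_small (i + 1) (by omega))
    have h_before : Nj β lam₀ K (i + 1) < b := by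
      by_contra! h
      linarith [sum_range_succ_mono hβ₀ h, sum_range_Nj_le (K := K) (h_zero (i + 1) (by omega))]
    have h_jump : ((i + 1 : ℕ) : ℝ) * lam₀ <
        ∑ k ∈ Finset.range (Nj β lam₀ K (i + 1) + 1 + 1), β k := by
      by_contra! h
      have := le_Nj (Nat.succ_le_of_lt (h_before.trans_le hb)) h
      omega
    rw [Finset.sum_range_succ] at h_jump
    have h_lower := sum_range_succ_mono ha h_before.le
    have h_step := hβ₁ (Nj β lam₀ K (i + 1) + 1)
    push_cast at hi h_sum h_lt h_jump
    constructor <;> linarith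
end

section
/- There exist constants δ_e > 0 and C > 0 (depending only on α, ε, θ, φ) with the following property. Let {Q} be a family of pairwise disjoint intervals in ℤ each of cardinality |Q| ≥ M^{α−1+ε}, let (C_{N,Q}) be nonnegative reals indexed by dyadic N with M^θ ≤ N ≤ M and by the cubes Q, with Σ_{N,Q} C_{N,Q} < ∞. Set ρ_{N,Q} = μ_N∗(1_Q/|Q|) and F_N(x) = Σ_Q C_{N,Q}·ρ_{N,Q}(x). Let {J} be the partition of ℤ into dyadic intervals of cardinality ≍ M^{θ−ε} and let E_{{J}} be the associated conditional expectation, E_{{J}}g(x) = (1/|J|)·Σ_{y∈J} g(y) for x ∈ J. Then Σ_{x∈ℤ} Σ_N |F_N(x) − E_{{J}}F_N(x)| ≤ C·M^{−δ_e}·Σ_{N,Q} C_{N,Q}. -/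
open scoped BigOperators

/-- `ρ_{N,Q} = μ_N ∗ (1_Q/|Q|)` for the interval `Q = [a,b] ∩ ℤ`. -/
noncomputable def rhoNQ (φ : ℝ → ℝ) (α : ℝ) (N : ℕ) (a b : ℤ) (x : ℤ) : ℝ :=
  (1 / ((Finset.Icc a b).card : ℝ)) * ∑ y ∈ Finset.Icc a b, mu φ α N (x - y)

/-- `F_N(x) = Σ_Q C_{N,Q} ρ_{N,Q}(x)` (here `N = 2^k`). -/
noncomputable def Ffun (φ : ℝ → ℝ) (α : ℝ) (𝒬 : Set (ℤ × ℤ)) (Cc : ℕ → ℤ × ℤ → ℝ)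
    (k : ℕ) (x : ℤ) : ℝ :=
  ∑' q : 𝒬, Cc k (q : ℤ × ℤ) * rhoNQ φ α (2 ^ k) (q : ℤ × ℤ).1 (q : ℤ × ℤ).2 x

/-- The conditional expectation w.r.t. the partition of `ℤ` into the intervals
`[nL, (n+1)L)`, `n ∈ ℤ`. -/
noncomputable def EJ (L : ℕ) (g : ℤ → ℝ) (x : ℤ) : ℝ :=
  (1 / (L : ℝ)) *
    ∑ y ∈ Finset.Ico (Int.ediv x L * L) ((Int.ediv x L + 1) * L), g y

/-- The smooth cut-off `v ↦ φ(v^{1/α})/(αv)` obtained from `φ(t)/t` by substituting `v = t^α`. -/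
noncomputable def powDensity (φ : ℝ → ℝ) (α : ℝ) (v : ℝ) : ℝ :=
  if v ≤ 1 / 2 then 0 else φ (v ^ (1 / α)) / (α * v)

section cutoff

variable {φ : ℝ → ℝ} {α : ℝ}

theorem eq_zero_of_le_one (hφs : Function.support φ ⊆ Set.Ioo 1 2) {t : ℝ} (ht : t ≤ 1) :
    φ t = 0 := by
  by_contra h
  exact absurd (hφs h).1 (not_lt.2 ht)

theorem eq_zero_of_two_le (hφs : Function.support φ ⊆ Set.Ioo 1 2) {t : ℝ} (ht : 2 ≤ t) :
    φ t = 0 := by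
  by_contra h
  exact absurd (hφs h).2 (not_lt.2 ht)

theorem powDensity_eq_zero_of_le_one (hα : 1 < α) (hφs : Function.support φ ⊆ Set.Ioo 1 2) {v : ℝ}
    (hv : v ≤ 1) : powDensity φ α v = 0 := by
  unfold powDensity
  split_ifs with h
  · rfl
  · rw [eq_zero_of_le_one hφs (Real.rpow_le_one (by linarith) hv (by positivity)), zero_div]

theorem powDensity_eq_zero_of_four_le (hα : 1 < α) (hα₂ : α ≤ 2)
    (hφs : Function.support φ ⊆ Set.Ioo 1 2) {v : ℝ} (hv : 4 ≤ v) : powDensity φ α v = 0 := by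
  have h2 : 2 ≤ v ^ (1 / α) := by
    rw [one_div, Real.le_rpow_inv_iff_of_pos (by norm_num) (by linarith) (by linarith)]
    calc (2 : ℝ) ^ α ≤ 2 ^ (2 : ℝ) := Real.rpow_le_rpow_of_exponent_le (by norm_num) hα₂
      _ = 4 := by norm_num
      _ ≤ v := hv
  rw [powDensity, if_neg (by linarith), eq_zero_of_two_le hφs h2, zero_div]

theorem contDiff_powDensity (hα : 1 < α) (hφ : ContDiff ℝ 1 φ)
    (hφs : Function.support φ ⊆ Set.Ioo 1 2) : ContDiff ℝ 1 (powDensity φ α) := by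
  rw [contDiff_iff_contDiffAt]
  intro v
  rcases lt_or_ge v 1 with hv | hv
  · refine (contDiffAt_const (c := (0 : ℝ))).congr_of_eventuallyEq ?_
    filter_upwards [Iio_mem_nhds hv] with w hw
    exact powDensity_eq_zero_of_le_one hα hφs (le_of_lt hw)
  · have hv0 : v ≠ 0 := by linarith
    have h : ContDiffAt ℝ 1 (fun w => φ (w ^ (1 / α)) / (α * w)) v :=
      (hφ.contDiffAt.comp v (contDiffAt_id.rpow_const_of_ne hv0)).div
        (contDiffAt_const.mul contDiffAt_id) (mul_ne_zero (by linarith) hv0)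
    refine h.congr_of_eventuallyEq ?_
    filter_upwards [Ioi_mem_nhds (show (1 / 2 : ℝ) < v by linarith)] with w hw
    exact if_neg (not_le.2 hw)

theorem contDiff_div_self (hφ : ContDiff ℝ 1 φ) (hφs : Function.support φ ⊆ Set.Ioo 1 2) :
    ContDiff ℝ 1 (fun t => φ t / t) := by
  rw [contDiff_iff_contDiffAt]
  intro v
  rcases lt_or_ge v 1 with hv | hv
  · refine (contDiffAt_const (c := (0 : ℝ))).congr_of_eventuallyEq ?_
    filter_upwards [Iio_mem_nhds hv] with w hw
    rw [eq_zero_of_le_one hφs (le_of_lt hw), zero_div]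
  · exact hφ.contDiffAt.div contDiffAt_id (show v ≠ 0 by linarith)

theorem exists_lipschitz_bound {g : ℝ → ℝ} (hg : ContDiff ℝ 1 g) {c d : ℝ}
    (h₁ : ∀ v ≤ c, g v = 0) (h₂ : ∀ v, d ≤ v → g v = 0) :
    ∃ K, 0 < K ∧ (∀ v, |g v| ≤ K) ∧ ∀ v w, |g v - g w| ≤ K * |v - w| := by
  have hc : HasCompactSupport g := by
    refine HasCompactSupport.of_support_subset_isCompact (isCompact_Icc (a := c) (b := d)) ?_
    intro v hv
    constructor
    · by_contra h
      exact hv (h₁ v (le_of_not_ge h))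
    · by_contra h
      exact hv (h₂ v (le_of_not_ge h))
  obtain ⟨K, hK⟩ := hg.lipschitzWith_of_hasCompactSupport hc one_ne_zero
  obtain ⟨B, hB⟩ := hc.exists_bound_of_continuous hg.continuous
  have hB0 : 0 ≤ B := (norm_nonneg _).trans (hB 0)
  refine ⟨K + B + 1, by positivity, fun v => ?_, fun v w => ?_⟩
  · have := hB v
    rw [Real.norm_eq_abs] at this
    linarith [K.coe_nonneg]
  · have := hK.dist_le_mul v w
    rw [Real.dist_eq, Real.dist_eq] at this
    nlinarith [abs_nonneg (v - w)]

/-- A primitive of `powDensity φ α`, constant outside `[1, 4]`. -/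
theorem exists_primitive_powDensity (hα : 1 < α) (hα₂ : α ≤ 2) (hφ : ContDiff ℝ 1 φ)
    (hφs : Function.support φ ⊆ Set.Ioo 1 2) :
    ∃ Ψ : ℝ → ℝ, (∀ v, HasDerivAt Ψ (powDensity φ α v) v) ∧ (∀ v ≤ 1, Ψ v = 0) ∧
      ∀ v, 4 ≤ v → Ψ v = Ψ 4 := by
  have hc : Continuous (powDensity φ α) := (contDiff_powDensity hα hφ hφs).continuous
  refine ⟨fun v => ∫ t in (1 : ℝ)..v, powDensity φ α t, fun v => ?_, fun v hv => ?_,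
    fun v hv => ?_⟩
  · exact intervalIntegral.integral_hasDerivAt_right (hc.intervalIntegrable _ _)
      (hc.stronglyMeasurableAtFilter _ _) hc.continuousAt
  · refine intervalIntegral.integral_zero_ae (Filter.Eventually.of_forall fun t ht => ?_)
    rw [Set.uIoc_of_ge hv] at ht
    exact powDensity_eq_zero_of_le_one hα hφs ht.2
  · have h := intervalIntegral.integral_add_adjacent_intervals
      (hc.intervalIntegrable (μ := MeasureTheory.volume) 1 4) (hc.intervalIntegrable 4 v)
    have h0 : ∫ t in (4 : ℝ)..v, powDensity φ α t = 0 := by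
      refine intervalIntegral.integral_zero_ae (Filter.Eventually.of_forall fun t ht => ?_)
      rw [Set.uIoc_of_le hv] at ht
      exact powDensity_eq_zero_of_four_le hα hα₂ hφs ht.1.le
    simp only [h0, add_zero] at h
    exact h.symm

theorem hasDerivAt_comp_rpow (hα : 1 < α) (hφs : Function.support φ ⊆ Set.Ioo 1 2)
    {Ψ : ℝ → ℝ} (hΨ : ∀ v, HasDerivAt Ψ (powDensity φ α v) v) {t : ℝ} (ht : 0 < t) :
    HasDerivAt (fun s => Ψ (s ^ α)) (φ t / t) t := by
  have h := (hΨ (t ^ α)).comp t (Real.hasDerivAt_rpow_const (p := α) (Or.inl ht.ne'))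
  refine HasDerivAt.congr_deriv (f := fun s => Ψ (s ^ α)) h ?_
  rcases le_or_gt t 1 with h1 | h1
  · rw [powDensity_eq_zero_of_le_one hα hφs (Real.rpow_le_one ht.le h1 (by linarith)),
      eq_zero_of_le_one hφs h1]
    simp
  · have h2 : ¬ t ^ α ≤ 1 / 2 := by
      have := Real.one_lt_rpow h1 (show 0 < α by linarith)
      linarith
    have hα0 : α ≠ 0 := by linarith
    have hp : t ^ α ≠ 0 := (Real.rpow_pos_of_pos ht α).ne'
    rw [powDensity, if_neg h2, one_div, Real.rpow_rpow_inv ht.le hα0, Real.rpow_sub ht,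
      Real.rpow_one]
    field_simp

theorem exists_slope_eq (hα : 1 < α) (hφs : Function.support φ ⊆ Set.Ioo 1 2)
    {Ψ : ℝ → ℝ} (hΨ : ∀ v, HasDerivAt Ψ (powDensity φ α v) v) {s t : ℝ} (hs : 0 ≤ s)
    (hst : s < t) : ∃ ξ ∈ Set.Ioo s t, Ψ (t ^ α) - Ψ (s ^ α) = φ ξ / ξ * (t - s) := by
  have hΨc : Continuous Ψ := continuous_iff_continuousAt.2 fun v => (hΨ v).continuousAt
  have hc : Continuous fun s : ℝ => Ψ (s ^ α) :=
    hΨc.comp (Real.continuous_rpow_const (by linarith))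
  obtain ⟨ξ, hξ, h⟩ := exists_hasDerivAt_eq_slope (fun s => Ψ (s ^ α)) (fun t => φ t / t) hst
    hc.continuousOn fun x hx => hasDerivAt_comp_rpow hα hφs hΨ (lt_of_le_of_lt hs hx.1)
  refine ⟨ξ, hξ, ?_⟩
  rw [h, div_mul_cancel₀]
  linarith

end cutoff


/-- The cumulative mass `Σ_{u < y} μ_N(u)`. -/
noncomputable def cumMass (φ : ℝ → ℝ) (α : ℝ) (N : ℕ) (y : ℤ) : ℝ :=
  ∑ m ∈ Finset.Icc N (2 * N),
    if ⌊(m : ℝ) ^ α⌋ < y then φ ((m : ℝ) / (N : ℝ)) / (m : ℝ) else 0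

section discrepancy

variable {φ : ℝ → ℝ} {α : ℝ} {N : ℕ}

theorem sum_mu_eq_sub (φ : ℝ → ℝ) (α : ℝ) (N : ℕ) {a b : ℤ} (hab : a ≤ b) (x : ℤ) :
    ∑ y ∈ Finset.Icc a b, mu φ α N (x - y) =
      cumMass φ α N (x - a + 1) - cumMass φ α N (x - b) := by
  unfold mu cumMass
  rw [Finset.sum_comm, ← Finset.sum_sub_distrib]
  refine Finset.sum_congr rfl fun m _ => ?_
  generalize φ ((m : ℝ) / (N : ℝ)) / (m : ℝ) = c
  generalize ⌊(m : ℝ) ^ α⌋ = z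
  have h : ∀ y, (if z = x - y then c else 0) = if y = x - z then c else 0 := fun y => by
    refine if_congr ?_ rfl rfl
    omega
  simp only [h, Finset.sum_ite_eq', Finset.mem_Icc]
  split_ifs <;> first | omega | simp

theorem cumMass_of_nonpos (φ : ℝ → ℝ) (α : ℝ) (N : ℕ) {y : ℤ} (hy : y ≤ 0) :
    cumMass φ α N y = 0 := by
  refine Finset.sum_eq_zero fun m _ => if_neg ?_
  have : 0 ≤ ⌊(m : ℝ) ^ α⌋ := Int.floor_nonneg.2 (by positivity)
  omega

theorem cumMass_of_four_mul_le (hα : 1 < α) (hα₂ : α < 2) (hN : 0 < N) {y : ℤ}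
    (hy : 4 * (N : ℝ) ^ α ≤ y) :
    cumMass φ α N y = ∑ m ∈ Finset.Icc N (2 * N), φ ((m : ℝ) / (N : ℝ)) / (m : ℝ) := by
  refine Finset.sum_congr rfl fun m hm => if_pos ?_
  rw [Int.floor_lt]
  refine lt_of_lt_of_le ?_ hy
  have hm2 : (m : ℝ) ≤ 2 * N := by exact_mod_cast (Finset.mem_Icc.1 hm).2
  have hNp : (0 : ℝ) < (N : ℝ) ^ α := Real.rpow_pos_of_pos (by exact_mod_cast hN) _
  calc (m : ℝ) ^ α ≤ (2 * N : ℝ) ^ α := Real.rpow_le_rpow (by positivity) hm2 (by linarith)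
    _ = 2 ^ α * (N : ℝ) ^ α := Real.mul_rpow (by norm_num) (by positivity)
    _ < 2 ^ (2 : ℝ) * (N : ℝ) ^ α := by
        gcongr 1
        exact Real.rpow_lt_rpow_of_exponent_lt (by norm_num) hα₂
    _ = 4 * (N : ℝ) ^ α := by norm_num

theorem cumMass_eq_sum_range (hα : 1 < α) (hφs : Function.support φ ⊆ Set.Ioo 1 2) (hN : 0 < N)
    {y : ℤ} (hy : 0 < y) :
    cumMass φ α N y = ∑ m ∈ Finset.range ⌈(y : ℝ) ^ α⁻¹⌉₊, φ ((m : ℝ) / (N : ℝ)) / (m : ℝ) := by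
  have hNr : (0 : ℝ) < N := by exact_mod_cast hN
  have hiff : ∀ m : ℕ, ⌊(m : ℝ) ^ α⌋ < y ↔ m < ⌈(y : ℝ) ^ α⁻¹⌉₊ := fun m => by
    rw [Int.floor_lt, Nat.lt_ceil, Real.lt_rpow_inv_iff_of_pos (by positivity)
      (by positivity) (by linarith)]
  have h0 : ∀ m : ℕ, m ∉ Finset.Icc N (2 * N) → φ ((m : ℝ) / (N : ℝ)) = 0 := fun m hm => by
    rw [Finset.mem_Icc, not_and_or, not_le, not_le] at hm
    rcases hm with hm | hm
    · refine eq_zero_of_le_one hφs ((div_le_one hNr).2 ?_)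
      exact_mod_cast hm.le
    · refine eq_zero_of_two_le hφs ((le_div_iff₀ hNr).2 ?_)
      exact_mod_cast hm.le
  unfold cumMass
  simp only [hiff]
  rw [← Finset.sum_filter]
  refine Finset.sum_subset (fun m hm => Finset.mem_range.2 (Finset.mem_filter.1 hm).2)
    fun m hm hm' => ?_
  rw [h0 m fun h => hm' (Finset.mem_filter.2 ⟨h, Finset.mem_range.1 hm⟩), zero_div]

theorem abs_cumMass_sub_le (hα : 1 < α) (hφs : Function.support φ ⊆ Set.Ioo 1 2)
    {Ψ : ℝ → ℝ} (hΨ : ∀ v, HasDerivAt Ψ (powDensity φ α v) v) (hΨ0 : ∀ v ≤ 1, Ψ v = 0)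
    {K : ℝ} (hK : 0 ≤ K) (hB : ∀ t, |φ t / t| ≤ K)
    (hL : ∀ s t, |φ s / s - φ t / t| ≤ K * |s - t|) (hN : 0 < N) (y : ℤ) :
    |cumMass φ α N y - Ψ (y / (N : ℝ) ^ α)| ≤ 2 * K / N := by
  have hNr : (0 : ℝ) < N := by exact_mod_cast hN
  have hNp : (0 : ℝ) < (N : ℝ) ^ α := Real.rpow_pos_of_pos hNr _
  rcases le_or_gt y 0 with hy | hy
  · have hy' : (y : ℝ) ≤ 0 := by exact_mod_cast hy
    rw [cumMass_of_nonpos φ α N hy, hΨ0, sub_zero, abs_zero]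
    · positivity
    · exact (div_nonpos_of_nonpos_of_nonneg hy' hNp.le).trans zero_le_one
  have hyr : (0 : ℝ) < y := by exact_mod_cast hy
  rw [cumMass_eq_sum_range hα hφs hN hy]
  set T : ℝ := (y : ℝ) ^ α⁻¹ with hT
  have hT0 : 0 < T := Real.rpow_pos_of_pos hyr _
  set n : ℕ := ⌈T⌉₊ with hn
  have hTy : (y : ℝ) / (N : ℝ) ^ α = (T / N) ^ α := by
    rw [Real.div_rpow hT0.le hNr.le, hT, Real.rpow_inv_rpow hyr.le (by linarith)]
  have hterm : ∀ m : ℕ, |φ ((m : ℝ) / N) / m -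
      (Ψ ((((m + 1 : ℕ) : ℝ) / N) ^ α) - Ψ (((m : ℝ) / N) ^ α))| ≤
        if m ∈ Finset.Ico N (2 * N) then K / (N : ℝ) ^ 2 else 0 := fun m => by
    obtain ⟨ξ, hξ, h⟩ := exists_slope_eq hα hφs hΨ (s := (m : ℝ) / N)
      (t := ((m + 1 : ℕ) : ℝ) / N) (by positivity) (by gcongr; simp)
    have hd : ((m + 1 : ℕ) : ℝ) / N - (m : ℝ) / N = 1 / N := by
      push_cast
      ring
    have hq : φ ((m : ℝ) / N) / m = φ ((m : ℝ) / N) / ((m : ℝ) / N) * (1 / N) := by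
      rw [div_div_eq_mul_div]
      field_simp
    rw [h, hd, hq, ← sub_mul]
    split_ifs with hm
    · rw [abs_mul, abs_of_pos (show (0 : ℝ) < 1 / N by positivity)]
      have h1 : |(m : ℝ) / N - ξ| ≤ 1 / N := by
        rw [abs_le]
        constructor <;> linarith [hξ.1, hξ.2]
      calc _ ≤ K * (1 / N) * (1 / N) := by
            gcongr
            exact (hL _ _).trans (by gcongr)
        _ = K / (N : ℝ) ^ 2 := by ring
    · rw [Finset.mem_Ico, not_and_or, not_le, not_lt] at hm
      have hz : φ ((m : ℝ) / N) = 0 ∧ φ ξ = 0 := by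
        rcases hm with hm | hm
        · have h1 : ((m + 1 : ℕ) : ℝ) / N ≤ 1 := by
            rw [div_le_one hNr]
            exact_mod_cast hm
          exact ⟨eq_zero_of_le_one hφs (by linarith [hξ.1, hξ.2]),
            eq_zero_of_le_one hφs (by linarith [hξ.2])⟩
        · have h1 : 2 ≤ (m : ℝ) / N := by
            rw [le_div_iff₀ hNr]
            exact_mod_cast hm
          exact ⟨eq_zero_of_two_le hφs h1, eq_zero_of_two_le hφs (by linarith [hξ.1])⟩
      simp [hz.1, hz.2]
  have hsum : |∑ m ∈ Finset.range n, φ ((m : ℝ) / N) / m - Ψ (((n : ℝ) / N) ^ α)| ≤ K / N := by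
    have htel := Finset.sum_range_sub (fun m : ℕ => Ψ (((m : ℝ) / N) ^ α)) n
    have h00 : Ψ ((((0 : ℕ) : ℝ) / N) ^ α) = 0 := by
      refine hΨ0 _ ?_
      rw [Nat.cast_zero, zero_div, Real.zero_rpow (by linarith)]
      exact zero_le_one
    rw [h00, sub_zero] at htel
    rw [← htel, ← Finset.sum_sub_distrib]
    calc _ ≤ ∑ m ∈ Finset.range n, _ := Finset.abs_sum_le_sum_abs _ _
      _ ≤ ∑ m ∈ Finset.range n, if m ∈ Finset.Ico N (2 * N) then K / (N : ℝ) ^ 2 else 0 :=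
          Finset.sum_le_sum fun m _ => hterm m
      _ ≤ ∑ m ∈ Finset.Ico N (2 * N), K / (N : ℝ) ^ 2 := by
          rw [← Finset.sum_filter]
          refine Finset.sum_le_sum_of_subset_of_nonneg
            (fun m hm => (Finset.mem_filter.1 hm).2) fun _ _ _ => by positivity
      _ = K / N := by
          have : 2 * N - N = N := by omega
          rw [Finset.sum_const, Nat.card_Ico, this, nsmul_eq_mul]
          field_simp
  have hlast : |Ψ (((n : ℝ) / N) ^ α) - Ψ ((T / N) ^ α)| ≤ K / N := by
    rcases (Nat.le_ceil T).eq_or_lt with h | h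
    · rw [← hn] at h
      rw [← h, sub_self, abs_zero]
      positivity
    · rw [← hn] at h
      obtain ⟨ξ, -, hξ⟩ := exists_slope_eq hα hφs hΨ (s := T / N) (t := (n : ℝ) / N)
        (by positivity) (by gcongr)
      have hlt : (n : ℝ) < T + 1 := Nat.ceil_lt_add_one hT0.le
      have h2 : |(n : ℝ) / N - T / N| ≤ 1 / N := by
        rw [← sub_div, abs_div, abs_of_pos hNr, abs_of_pos (by linarith)]
        gcongr
        linarith
      rw [hξ, abs_mul]
      calc _ ≤ K * (1 / N) := by
            gcongr
            exact hB ξ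
        _ = K / N := by ring
  rw [hTy]
  calc _ ≤ K / N + K / N := (abs_sub_le _ _ _).trans (add_le_add hsum hlast)
    _ = 2 * K / N := by ring

end discrepancy


section translation

theorem sum_comp_add_le {f : ℤ → ℝ} {B : ℝ} (h : ∀ s : Finset ℤ, ∑ x ∈ s, f x ≤ B) (j : ℤ)
    (s : Finset ℤ) : ∑ x ∈ s, f (x + j) ≤ B := by
  simpa using h (s.map (Equiv.addRight j).toEmbedding)

/-- If `g` is `ℓ¹`-close to its translates by less than `L`, it is `ℓ¹`-close to its averages over
intervals of length `L`. -/
theorem sum_abs_sub_EJ_le {g : ℤ → ℝ} {L : ℕ} (hL : 0 < L) {B : ℝ}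
    (h : ∀ j ∈ Finset.Ioo (-(L : ℤ)) L, ∀ s : Finset ℤ, ∑ x ∈ s, |g x - g (x + j)| ≤ B)
    (s : Finset ℤ) : ∑ x ∈ s, |g x - EJ L g x| ≤ 2 * B := by
  have hLr : (0 : ℝ) < L := by exact_mod_cast hL
  have hLz : (0 : ℤ) < L := by exact_mod_cast hL
  have hB : 0 ≤ B := by
    simpa using h 0 (Finset.mem_Ioo.2 ⟨by omega, hLz⟩) ∅
  have hpt : ∀ x, |g x - EJ L g x| ≤
      (1 / (L : ℝ)) * ∑ j ∈ Finset.Ioo (-(L : ℤ)) L, |g x - g (x + j)| := fun x => by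
    set J := Finset.Ico (Int.ediv x L * L) ((Int.ediv x L + 1) * L) with hJ
    have hcard : J.card = L := by
      rw [hJ, Int.card_Ico, ← sub_mul]
      simp
    have h1 : Int.ediv x L * L ≤ x := Int.ediv_mul_le x hLz.ne'
    have h2 : x < (Int.ediv x L + 1) * L := Int.lt_ediv_add_one_mul_self x hLz
    have heq : g x - EJ L g x = (1 / (L : ℝ)) * ∑ y ∈ J, (g x - g y) := by
      rw [EJ, ← hJ, Finset.sum_sub_distrib, Finset.sum_const, hcard, nsmul_eq_mul]
      field_simp
    rw [heq, abs_mul, abs_of_pos (by positivity : (0 : ℝ) < 1 / L)]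
    gcongr
    calc _ ≤ ∑ y ∈ J, |g x - g y| := Finset.abs_sum_le_sum_abs _ _
      _ ≤ ∑ y ∈ (Finset.Ioo (-(L : ℤ)) L).map (Equiv.addLeft x).toEmbedding, |g x - g y| := by
          refine Finset.sum_le_sum_of_subset_of_nonneg (fun y hy => ?_) fun _ _ _ => abs_nonneg _
          rw [hJ, Finset.mem_Ico] at hy
          rw [Finset.mem_map_equiv]
          simp only [Equiv.addLeft_symm, Equiv.coe_addLeft, Finset.mem_Ioo]
          constructor <;> linarith [hy.1, hy.2]
      _ = _ := by simp
  calc ∑ x ∈ s, |g x - EJ L g x|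
      ≤ ∑ x ∈ s, (1 / (L : ℝ)) * ∑ j ∈ Finset.Ioo (-(L : ℤ)) L, |g x - g (x + j)| :=
        Finset.sum_le_sum fun x _ => hpt x
    _ = (1 / (L : ℝ)) * ∑ j ∈ Finset.Ioo (-(L : ℤ)) L, ∑ x ∈ s, |g x - g (x + j)| := by
        rw [← Finset.mul_sum, Finset.sum_comm]
    _ ≤ (1 / (L : ℝ)) * ∑ j ∈ Finset.Ioo (-(L : ℤ)) L, B := by
        gcongr with j hj
        exact h j hj s
    _ ≤ (1 / (L : ℝ)) * ((2 * L : ℝ) * B) := by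
        rw [Finset.sum_const, nsmul_eq_mul]
        gcongr
        rw [Int.card_Ioo]
        have : ((L : ℤ) - -(L : ℤ) - 1).toNat ≤ 2 * L := by omega
        exact_mod_cast this
    _ = 2 * B := by field_simp

theorem sum_Icc_sub_telescope (G : ℤ → ℝ) (x : ℤ) {a b : ℤ} (hab : a ≤ b) :
    ∑ y ∈ Finset.Icc a b, (G (x - y + 1) - G (x - y)) = G (x - a + 1) - G (x - b) := by
  induction b, hab using Int.leInduction with
  | base => simp
  | succ b hb ih =>
    rw [← Finset.insert_Icc_right_eq_Icc_add_one (by omega), Finset.sum_insert (by simp), ih,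
      show x - (b + 1) + 1 = x - b by ring]
    ring

/-- Bounding an `ℓ¹` sum by the size of the support times the supremum. -/
theorem sum_abs_le_card_mul {f : ℤ → ℝ} {t : Finset ℤ} {c : ℝ}
    (h₀ : ∀ x, x ∉ t → f x = 0) (h : ∀ x, |f x| ≤ c) (s : Finset ℤ) :
    ∑ x ∈ s, |f x| ≤ t.card * c := by
  calc ∑ x ∈ s, |f x| = ∑ x ∈ s with x ∈ t, |f x| := by
        refine (Finset.sum_filter_of_ne fun x _ hx => ?_).symm
        by_contra hxt
        exact hx (by rw [h₀ x hxt, abs_zero])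
    _ ≤ ∑ x ∈ t, |f x| := Finset.sum_le_sum_of_subset_of_nonneg
        (fun x hx => (Finset.mem_filter.1 hx).2) fun _ _ _ => abs_nonneg _
    _ ≤ ∑ x ∈ t, c := Finset.sum_le_sum fun x _ => h x
    _ = t.card * c := by rw [Finset.sum_const, nsmul_eq_mul]

variable {Ψ γ : ℝ → ℝ} {K A : ℝ}

theorem abs_increment_sub_le (hΨ : ∀ v, HasDerivAt Ψ (γ v) v)
    (hγ : ∀ v w, |γ v - γ w| ≤ K * |v - w|) (hA : 0 < A) (t u : ℝ) :
    |(Ψ ((t + 1) / A) - Ψ (t / A)) - (Ψ ((u + 1) / A) - Ψ (u / A))| ≤ K / A ^ 2 * |t - u| := by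
  have hd : ∀ t, HasDerivAt (fun t => Ψ ((t + 1) / A) - Ψ (t / A))
      (γ ((t + 1) / A) * (1 / A) - γ (t / A) * (1 / A)) t := fun t => by
    have h1 : HasDerivAt (fun t : ℝ => (t + 1) / A) (1 / A) t :=
      ((hasDerivAt_id t).add_const 1).div_const A
    have h2 : HasDerivAt (fun t : ℝ => t / A) (1 / A) t := (hasDerivAt_id t).div_const A
    exact ((hΨ _).comp t h1).sub ((hΨ _).comp t h2)
  have hb : ∀ t, ‖γ ((t + 1) / A) * (1 / A) - γ (t / A) * (1 / A)‖ ≤ K / A ^ 2 := fun t => by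
    rw [← sub_mul, norm_mul, Real.norm_eq_abs, Real.norm_eq_abs, abs_of_pos (one_div_pos.2 hA)]
    calc _ ≤ K * |(t + 1) / A - t / A| * (1 / A) := by
          gcongr
          exact hγ _ _
      _ = K / A ^ 2 := by
          rw [← sub_div, add_sub_cancel_left, abs_of_pos (one_div_pos.2 hA)]
          ring
  exact convex_univ.norm_image_sub_le_of_norm_hasDerivWithin_le
    (fun x _ => (hd x).hasDerivWithinAt) (fun x _ => hb x) (Set.mem_univ u) (Set.mem_univ t)

theorem sum_abs_increment_sub_le (hΨ : ∀ v, HasDerivAt Ψ (γ v) v) (hΨ0 : ∀ v ≤ 1, Ψ v = 0)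
    (hΨ4 : ∀ v, 4 ≤ v → Ψ v = Ψ 4) (hγ : ∀ v w, |γ v - γ w| ≤ K * |v - w|) (hK : 0 ≤ K)
    (hA : 1 ≤ A) (j : ℤ) (s : Finset ℤ) :
    ∑ u ∈ s, |(Ψ (((u + 1 : ℤ) : ℝ) / A) - Ψ ((u : ℝ) / A)) -
      (Ψ (((u + j + 1 : ℤ) : ℝ) / A) - Ψ (((u + j : ℤ) : ℝ) / A))| ≤ 10 * K * |(j : ℝ)| / A := by
  have hA0 : 0 < A := by linarith
  set t : Finset ℤ := Finset.Icc 0 ⌊4 * A⌋ with ht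
  have hfl : 0 ≤ ⌊4 * A⌋ := Int.floor_nonneg.2 (by positivity)
  have hcard : (t.card : ℝ) ≤ 5 * A := by
    have h1 : (t.card : ℤ) = ⌊4 * A⌋ + 1 := by
      rw [ht, Int.card_Icc]
      omega
    have h2 : (t.card : ℝ) = ⌊4 * A⌋ + 1 := by exact_mod_cast h1
    linarith [Int.floor_le (4 * A)]
  have hz : ∀ u : ℤ, u ∉ t → Ψ (((u + 1 : ℤ) : ℝ) / A) - Ψ ((u : ℝ) / A) = 0 := fun u hu => by
    rw [ht, Finset.mem_Icc, not_and_or, not_le, not_le] at hu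
    rcases hu with hu | hu
    · have h1 : ((u + 1 : ℤ) : ℝ) ≤ 0 := by exact_mod_cast hu
      have h2 : (u : ℝ) ≤ 0 := by exact_mod_cast hu.le
      rw [hΨ0 _ ((div_nonpos_of_nonpos_of_nonneg h1 hA0.le).trans zero_le_one),
        hΨ0 _ ((div_nonpos_of_nonpos_of_nonneg h2 hA0.le).trans zero_le_one), sub_zero]
    · have h1 : 4 * A < u := Int.floor_lt.1 hu
      have h2 : 4 * A < ((u + 1 : ℤ) : ℝ) := by
        push_cast
        linarith
      rw [hΨ4 _ ((le_div_iff₀ hA0).2 h1.le), hΨ4 _ ((le_div_iff₀ hA0).2 h2.le), sub_self]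
  have h := sum_abs_le_card_mul (t := t ∪ t.map (Equiv.subRight j).toEmbedding)
    (c := K / A ^ 2 * |(j : ℝ)|)
    (f := fun u => (Ψ (((u + 1 : ℤ) : ℝ) / A) - Ψ ((u : ℝ) / A)) -
      (Ψ (((u + j + 1 : ℤ) : ℝ) / A) - Ψ (((u + j : ℤ) : ℝ) / A))) (fun u hu => ?_) (fun u => ?_) s
  · refine h.trans ?_
    have hc2 : ((t ∪ t.map (Equiv.subRight j).toEmbedding).card : ℝ) ≤ 10 * A := by
      have := Finset.card_union_le t (t.map (Equiv.subRight j).toEmbedding)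
      rw [Finset.card_map] at this
      have h3 : ((t ∪ t.map (Equiv.subRight j).toEmbedding).card : ℝ) ≤ t.card + t.card := by
        exact_mod_cast this
      linarith
    calc _ ≤ 10 * A * (K / A ^ 2 * |(j : ℝ)|) := by gcongr
      _ = _ := by field_simp
  · rw [Finset.mem_union, not_or, Finset.mem_map_equiv] at hu
    have hu2 : u + j ∉ t := by simpa using hu.2
    simp only [hz u hu.1, hz (u + j) hu2, sub_zero]
  · have := abs_increment_sub_le hΨ hγ hA0 (u : ℝ) ((u + j : ℤ) : ℝ)
    have he : (u : ℝ) - ((u + j : ℤ) : ℝ) = -(j : ℝ) := by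
      push_cast
      ring
    rw [he, abs_neg] at this
    push_cast at this ⊢
    exact this

end translation


/-- The `ℓ¹` distance between `ρ_{N,Q}` and its conditional expectation. -/
theorem exists_sum_abs_rhoNQ_sub_EJ_le {φ : ℝ → ℝ} {α : ℝ} (hα : 1 < α) (hα₂ : α < 2)
    (hφ : ContDiff ℝ 1 φ) (hφs : Function.support φ ⊆ Set.Ioo 1 2) :
    ∃ C, 0 < C ∧ ∀ N L : ℕ, 0 < N → 0 < L → ∀ a b : ℤ, a ≤ b → ∀ s : Finset ℤ,
      ∑ x ∈ s, |rhoNQ φ α N a b x - EJ L (rhoNQ φ α N a b) x| ≤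
        C * (1 / N + (N : ℝ) ^ α / (N * (Finset.Icc a b).card) + L / (N : ℝ) ^ α) := by
  obtain ⟨K₁, hK₁, hB, hη⟩ := exists_lipschitz_bound (contDiff_div_self hφ hφs) (c := 1) (d := 2)
    (fun v hv => by rw [eq_zero_of_le_one hφs hv, zero_div])
    (fun v hv => by rw [eq_zero_of_two_le hφs hv, zero_div])
  obtain ⟨K₂, hK₂, -, hγ⟩ := exists_lipschitz_bound (contDiff_powDensity hα hφ hφs)
    (fun v hv => powDensity_eq_zero_of_le_one hα hφs hv)
    (fun v hv => powDensity_eq_zero_of_four_le hα hα₂.le hφs hv)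
  obtain ⟨Ψ, hΨ, hΨ0, hΨ4⟩ := exists_primitive_powDensity hα hα₂.le hφ hφs
  refine ⟨64 * K₁ + 20 * K₂, by positivity, fun N L hN hL a b hab s => ?_⟩
  have hNr : (0 : ℝ) < N := by exact_mod_cast hN
  have hA1 : 1 ≤ (N : ℝ) ^ α := Real.one_le_rpow (by exact_mod_cast hN) (by linarith)
  have hdisc := abs_cumMass_sub_le hα hφs hΨ hΨ0 hK₁.le hB hη hN
  have hcum4 := fun y => cumMass_of_four_mul_le (φ := φ) (y := y) hα hα₂ hN
  set A : ℝ := (N : ℝ) ^ α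
  have hA0 : 0 < A := by linarith
  have hHz : ((Finset.Icc a b).card : ℤ) = b + 1 - a := by
    rw [Int.card_Icc]
    omega
  have hH0 : (0 : ℝ) < (Finset.Icc a b).card := by
    have : (0 : ℤ) < (Finset.Icc a b).card := by omega
    exact_mod_cast this
  set H : ℝ := ((Finset.Icc a b).card : ℝ) with hH
  set e : ℤ → ℝ := fun y => cumMass φ α N y - Ψ (y / A) with he
  set R : ℤ → ℝ := fun x => 1 / H * (e (x - a + 1) - e (x - b)) with hR
  set σ : ℤ → ℝ := fun u => Ψ (((u + 1 : ℤ) : ℝ) / A) - Ψ ((u : ℝ) / A) with hσ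
  set S : ℤ → ℝ := fun x => 1 / H * ∑ y ∈ Finset.Icc a b, σ (x - y) with hS
  have hρ : ∀ x, rhoNQ φ α N a b x = R x + S x := fun x => by
    have h1 := sum_Icc_sub_telescope (fun u : ℤ => Ψ ((u : ℝ) / A)) x hab
    simp only [hR, hS, hσ, he, rhoNQ]
    rw [sum_mu_eq_sub φ α N hab, h1]
    ring
  have he0 : ∀ y ≤ 0, e y = 0 := fun y hy => by
    have hy' : (y : ℝ) ≤ 0 := by exact_mod_cast hy
    simp only [he]
    rw [cumMass_of_nonpos φ α N hy,
      hΨ0 _ ((div_nonpos_of_nonpos_of_nonneg hy' hA0.le).trans zero_le_one), sub_zero]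
  have he4 : ∀ y z : ℤ, 4 * A ≤ y → 4 * A ≤ z → e y = e z := fun y z hy hz => by
    simp only [he]
    rw [hcum4 y hy, hcum4 z hz, hΨ4 _ ((le_div_iff₀ hA0).2 hy), hΨ4 _ ((le_div_iff₀ hA0).2 hz)]
  have hRsum : ∀ s : Finset ℤ, ∑ x ∈ s, |R x| ≤ (H + 4 * A) * (4 * K₁ / (N * H)) := fun s => by
    refine (sum_abs_le_card_mul (t := Finset.Icc a (b + ⌊4 * A⌋)) (c := 4 * K₁ / (N * H))
      (fun x hx => ?_) (fun x => ?_) s).trans ?_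
    · rw [Finset.mem_Icc, not_and_or, not_le, not_le] at hx
      rcases hx with hx | hx
      · simp only [hR]
        rw [he0 _ (by omega), he0 _ (by omega), sub_zero, mul_zero]
      · have h1 : 4 * A < ((x - b : ℤ) : ℝ) := Int.floor_lt.1 (by omega)
        have h2 : ((x - b : ℤ) : ℝ) ≤ ((x - a + 1 : ℤ) : ℝ) := by
          exact_mod_cast (by omega : x - b ≤ x - a + 1)
        simp only [hR]
        rw [he4 _ _ (h1.le.trans h2) h1.le, sub_self, mul_zero]
    · simp only [hR]
      rw [abs_mul, abs_of_pos (one_div_pos.2 hH0)]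
      calc _ ≤ 1 / H * (2 * K₁ / N + 2 * K₁ / N) := by
            gcongr
            exact (abs_sub _ _).trans (add_le_add (hdisc _) (hdisc _))
        _ = _ := by
            field_simp
            ring
    · gcongr
      have hfl : 0 ≤ ⌊4 * A⌋ := Int.floor_nonneg.2 (by positivity)
      have h1 : ((Finset.Icc a (b + ⌊4 * A⌋)).card : ℤ) = (Finset.Icc a b).card + ⌊4 * A⌋ := by
        rw [hHz, Int.card_Icc]
        omega
      have h2 : ((Finset.Icc a (b + ⌊4 * A⌋)).card : ℝ) = H + ⌊4 * A⌋ := by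
        rw [hH]
        exact_mod_cast h1
      linarith [Int.floor_le (4 * A)]
  have hSsum : ∀ (j : ℤ) (s : Finset ℤ), ∑ x ∈ s, |S x - S (x + j)| ≤ 10 * K₂ * |(j : ℝ)| / A :=
    fun j s => by
    have h1 := sum_abs_increment_sub_le hΨ hΨ0 hΨ4 hγ hK₂.le hA1 j
    calc ∑ x ∈ s, |S x - S (x + j)|
        ≤ ∑ x ∈ s, 1 / H * ∑ y ∈ Finset.Icc a b, |σ (x - y) - σ (x - y + j)| := by
          refine Finset.sum_le_sum fun x _ => ?_
          simp only [hS]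
          rw [← mul_sub, ← Finset.sum_sub_distrib, abs_mul, abs_of_pos (one_div_pos.2 hH0)]
          gcongr
          refine (Finset.abs_sum_le_sum_abs _ _).trans_eq (Finset.sum_congr rfl fun y _ => ?_)
          rw [show x + j - y = x - y + j by ring]
      _ = 1 / H * ∑ y ∈ Finset.Icc a b, ∑ x ∈ s, |σ (x + -y) - σ (x + -y + j)| := by
          rw [← Finset.mul_sum, Finset.sum_comm]
          rfl
      _ ≤ 1 / H * ∑ y ∈ Finset.Icc a b, 10 * K₂ * |(j : ℝ)| / A := by
          gcongr with y _
          exact sum_comp_add_le (f := fun u => |σ u - σ (u + j)|) h1 (-y) s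
      _ = 10 * K₂ * |(j : ℝ)| / A := by
          rw [Finset.sum_const, nsmul_eq_mul, ← hH, ← mul_assoc, one_div_mul_cancel hH0.ne',
            one_mul]
  have hmain := sum_abs_sub_EJ_le (g := rhoNQ φ α N a b) hL
    (B := 2 * ((H + 4 * A) * (4 * K₁ / (N * H))) + 10 * K₂ * L / A) (fun j hj s => ?_) s
  · refine hmain.trans ?_
    have heq : 2 * (2 * ((H + 4 * A) * (4 * K₁ / (N * H))) + 10 * K₂ * L / A) =
        16 * K₁ * (1 / N) + 64 * K₁ * (A / (N * H)) + 20 * K₂ * (L / A) := by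
      field_simp
      ring
    rw [heq]
    have p1 : 0 ≤ 1 / (N : ℝ) := by positivity
    have p2 : 0 ≤ A / (N * H) := by positivity
    have p3 : 0 ≤ (L : ℝ) / A := by positivity
    nlinarith [mul_nonneg hK₁.le p1, mul_nonneg hK₁.le p2, mul_nonneg hK₁.le p3,
      mul_nonneg hK₂.le p1, mul_nonneg hK₂.le p2, mul_nonneg hK₂.le p3]
  · have hj' : |(j : ℝ)| ≤ L := by
      rw [Finset.mem_Ioo] at hj
      have : |j| ≤ (L : ℤ) := abs_le.2 ⟨hj.1.le, hj.2.le⟩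
      exact_mod_cast this
    calc _ ≤ ∑ x ∈ s, (|R x| + |R (x + j)| + |S x - S (x + j)|) := by
          refine Finset.sum_le_sum fun x _ => ?_
          rw [hρ, hρ, add_sub_add_comm]
          exact (abs_add_le _ _).trans (by gcongr; exact abs_sub _ _)
      _ ≤ (H + 4 * A) * (4 * K₁ / (N * H)) + (H + 4 * A) * (4 * K₁ / (N * H)) +
            10 * K₂ * |(j : ℝ)| / A := by
          rw [Finset.sum_add_distrib, Finset.sum_add_distrib]
          exact add_le_add (add_le_add (hRsum s)
            (sum_comp_add_le (f := fun x => |R x|) hRsum j s)) (hSsum j s)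
      _ ≤ 2 * ((H + 4 * A) * (4 * K₁ / (N * H))) + 10 * K₂ * L / A := by
          rw [← two_mul]
          gcongr


theorem abs_rhoNQ_le (φ : ℝ → ℝ) (α : ℝ) (N : ℕ) (a b x : ℤ) :
    |rhoNQ φ α N a b x| ≤ ∑ m ∈ Finset.Icc N (2 * N), |φ ((m : ℝ) / N) / m| := by
  set D := ∑ m ∈ Finset.Icc N (2 * N), |φ ((m : ℝ) / N) / m| with hD
  have hD0 : 0 ≤ D := Finset.sum_nonneg fun _ _ => abs_nonneg _
  have hmu : ∀ z, |mu φ α N z| ≤ D := fun z => by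
    refine (Finset.abs_sum_le_sum_abs _ _).trans (Finset.sum_le_sum fun m _ => ?_)
    split_ifs
    · exact le_rfl
    · simp
  rw [rhoNQ, abs_mul, abs_of_nonneg (by positivity : 0 ≤ 1 / ((Finset.Icc a b).card : ℝ))]
  calc _ ≤ 1 / ((Finset.Icc a b).card : ℝ) * ((Finset.Icc a b).card * D) := by
        gcongr
        rw [← nsmul_eq_mul, ← Finset.sum_const]
        exact (Finset.abs_sum_le_sum_abs _ _).trans (Finset.sum_le_sum fun y _ => hmu _)
    _ = (Finset.Icc a b).card / (Finset.Icc a b).card * D := by ring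
    _ ≤ 1 * D := by
        gcongr
        exact div_self_le_one _
    _ = D := one_mul D

theorem sum_abs_Ffun_sub_EJ_le {φ : ℝ → ℝ} {α : ℝ} {𝒬 : Set (ℤ × ℤ)} {Cc : ℕ → ℤ × ℤ → ℝ}
    {k L : ℕ} {B : ℝ} (hC : ∀ q, 0 ≤ Cc k q) (hs : Summable fun q : 𝒬 => Cc k (q : ℤ × ℤ))
    (hB : ∀ q ∈ 𝒬, ∀ s : Finset ℤ,
      ∑ x ∈ s, |rhoNQ φ α (2 ^ k) q.1 q.2 x - EJ L (rhoNQ φ α (2 ^ k) q.1 q.2) x| ≤ B)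
    (s : Finset ℤ) :
    ∑ x ∈ s, |Ffun φ α 𝒬 Cc k x - EJ L (Ffun φ α 𝒬 Cc k) x| ≤
      B * ∑' q : 𝒬, Cc k (q : ℤ × ℤ) := by
  have hF : ∀ x, HasSum (fun q : 𝒬 => Cc k (q : ℤ × ℤ) *
      rhoNQ φ α (2 ^ k) (q : ℤ × ℤ).1 (q : ℤ × ℤ).2 x) (Ffun φ α 𝒬 Cc k x) := fun x => by
    refine Summable.hasSum (Summable.of_norm_bounded (hs.mul_right
      (∑ m ∈ Finset.Icc (2 ^ k : ℕ) (2 * 2 ^ k), |φ ((m : ℝ) / (2 ^ k : ℕ)) / m|)) fun q => ?_)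
    rw [Real.norm_eq_abs, abs_mul, abs_of_nonneg (hC _)]
    exact mul_le_mul_of_nonneg_left (abs_rhoNQ_le φ α (2 ^ k) _ _ x) (hC _)
  have hd : ∀ x, HasSum (fun q : 𝒬 => Cc k (q : ℤ × ℤ) *
      (rhoNQ φ α (2 ^ k) (q : ℤ × ℤ).1 (q : ℤ × ℤ).2 x -
        EJ L (rhoNQ φ α (2 ^ k) (q : ℤ × ℤ).1 (q : ℤ × ℤ).2) x))
      (Ffun φ α 𝒬 Cc k x - EJ L (Ffun φ α 𝒬 Cc k) x) := fun x => by
    refine ((hF x).sub ((hasSum_sum (s := Finset.Ico (Int.ediv x L * L)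
      ((Int.ediv x L + 1) * L)) fun y _ => hF y).mul_left (1 / (L : ℝ)))).congr_fun fun q => ?_
    rw [EJ, ← Finset.mul_sum]
    ring
  calc ∑ x ∈ s, |Ffun φ α 𝒬 Cc k x - EJ L (Ffun φ α 𝒬 Cc k) x|
      ≤ ∑ x ∈ s, ∑' q : 𝒬, |Cc k (q : ℤ × ℤ) *
        (rhoNQ φ α (2 ^ k) (q : ℤ × ℤ).1 (q : ℤ × ℤ).2 x -
          EJ L (rhoNQ φ α (2 ^ k) (q : ℤ × ℤ).1 (q : ℤ × ℤ).2) x)| := by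
        refine Finset.sum_le_sum fun x _ => ?_
        rw [← (hd x).tsum_eq]
        exact norm_tsum_le_tsum_norm (hd x).summable.norm
    _ = ∑' q : 𝒬, ∑ x ∈ s, |Cc k (q : ℤ × ℤ) *
        (rhoNQ φ α (2 ^ k) (q : ℤ × ℤ).1 (q : ℤ × ℤ).2 x -
          EJ L (rhoNQ φ α (2 ^ k) (q : ℤ × ℤ).1 (q : ℤ × ℤ).2) x)| :=
        (Summable.tsum_finsetSum fun x _ => (hd x).summable.abs).symm
    _ ≤ ∑' q : 𝒬, B * Cc k (q : ℤ × ℤ) := by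
        refine Summable.tsum_le_tsum (fun q => ?_)
          (summable_sum fun x _ => (hd x).summable.abs) (hs.mul_left B)
        simp only [abs_mul, abs_of_nonneg (hC _)]
        rw [← Finset.mul_sum, mul_comm B]
        exact mul_le_mul_of_nonneg_left (hB q q.2 s) (hC _)
    _ = B * ∑' q : 𝒬, Cc k (q : ℤ × ℤ) := tsum_mul_left

/-- The three error terms are a negative power of `M` in the relevant range of parameters. -/
theorem error_terms_le {M N L H α ε θ : ℝ} (hM : 1 ≤ M) (hα : 1 < α) (hθ : 0 < θ)
    (hN : M ^ θ ≤ N) (hNM : N ≤ M) (hH : M ^ (α - 1 + ε) ≤ H) (hL : L ≤ 2 * M ^ (θ - ε)) :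
    1 / N + N ^ α / (N * H) + L / N ^ α ≤ 4 * M ^ (-(min ε θ)) := by
  have hM0 : 0 < M := by linarith
  have hN0 : 0 < N := (Real.rpow_pos_of_pos hM0 θ).trans_le hN
  have hN1 : 1 ≤ N := (Real.one_le_rpow hM hθ.le).trans hN
  have hmono : ∀ δ, min ε θ ≤ δ → M ^ (-δ) ≤ M ^ (-(min ε θ)) := fun δ h =>
    Real.rpow_le_rpow_of_exponent_le hM (neg_le_neg h)
  have h1 : 1 / N ≤ M ^ (-(min ε θ)) := by
    refine le_trans ?_ (hmono θ (min_le_right _ _))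
    rw [Real.rpow_neg hM0.le, one_div]
    gcongr
  have h2 : N ^ α / (N * H) ≤ M ^ (-(min ε θ)) := by
    refine le_trans ?_ (hmono ε (min_le_left _ _))
    have hNα : N ^ α / (N * H) = N ^ (α - 1) / H := by
      rw [Real.rpow_sub hN0, Real.rpow_one, div_div]
    have hp : M ^ (-ε) = M ^ (α - 1) / M ^ (α - 1 + ε) := by
      rw [← Real.rpow_sub hM0]
      congr 1
      ring
    rw [hNα, hp]
    have : 0 ≤ α - 1 := by linarith
    gcongr
  have h3 : L / N ^ α ≤ 2 * M ^ (-(min ε θ)) := by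
    refine le_trans ?_ (mul_le_mul_of_nonneg_left (hmono ε (min_le_left _ _)) zero_le_two)
    have hNα : M ^ θ ≤ N ^ α := hN.trans (Real.self_le_rpow_of_one_le hN1 hα.le)
    rw [div_le_iff₀ (Real.rpow_pos_of_pos hN0 α)]
    calc L ≤ 2 * M ^ (θ - ε) := hL
      _ = 2 * M ^ (-ε) * M ^ θ := by
          rw [mul_assoc, ← Real.rpow_add hM0]
          congr 2
          ring
      _ ≤ 2 * M ^ (-ε) * N ^ α := by gcongr
  linarith

/-- The error `Σ_x Σ_N |F_N(x) − E_{{J}}F_N(x)|` is at most `C M^{−δ_e} Σ_{N,Q} C_{N,Q}`. -/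
theorem error_function_estimate (α : ℝ) (hα₁ : 1 < α) (hα₂ : α ≤ 1 + 1 / 1000)
    (φ : ℝ → ℝ) (hφ : ContDiff ℝ (⊤ : ℕ∞) φ) (hφs : Function.support φ ⊆ Set.Ioo 1 2)
    (ε : ℝ) (hε : 0 < ε) :
    ∃ θ₀ : ℝ, 0 < θ₀ ∧ θ₀ < 1 ∧
      ∀ θ : ℝ, θ₀ < θ → θ < 1 →
      ∃ δe C : ℝ, 0 < δe ∧ 0 < C ∧
      ∀ (KM L : ℕ), 0 < L →
        (1 / 2) * ((2 : ℝ) ^ KM) ^ (θ - ε) ≤ (L : ℝ) →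
        (L : ℝ) ≤ 2 * ((2 : ℝ) ^ KM) ^ (θ - ε) →
      ∀ (𝒬 : Set (ℤ × ℤ)) (Cc : ℕ → ℤ × ℤ → ℝ),
        (∀ q ∈ 𝒬, q.1 ≤ q.2) →
        (∀ q ∈ 𝒬, ((2 : ℝ) ^ KM) ^ (α - 1 + ε) ≤ ((Finset.Icc q.1 q.2).card : ℝ)) →
        (𝒬.PairwiseDisjoint fun q => ((Finset.Icc q.1 q.2 : Finset ℤ) : Set ℤ)) →
        (∀ k q, 0 ≤ Cc k q) →
        (∀ k, Summable fun q : 𝒬 => Cc k (q : ℤ × ℤ)) →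
        ∑' x : ℤ,
            ∑ k ∈ Finset.range (KM + 1),
              (if ((2 : ℝ) ^ KM) ^ θ ≤ (2 : ℝ) ^ k then
                |Ffun φ α 𝒬 Cc k x - EJ L (Ffun φ α 𝒬 Cc k) x|
              else 0) ≤
          C * ((2 : ℝ) ^ KM) ^ (-δe) *
            ∑ k ∈ Finset.range (KM + 1),
              (if ((2 : ℝ) ^ KM) ^ θ ≤ (2 : ℝ) ^ k then ∑' q : 𝒬, Cc k (q : ℤ × ℤ)
              else 0) := by
  have hα₃ : α < 2 := by linarith
  obtain ⟨C, hC, hmain⟩ := exists_sum_abs_rhoNQ_sub_EJ_le hα₁ hα₃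
    (hφ.of_le (by exact_mod_cast le_top)) hφs
  refine ⟨1 / 2, by norm_num, by norm_num, fun θ hθ _ => ⟨min ε θ, 4 * C, ?_, by positivity, ?_⟩⟩
  · exact lt_min hε (by linarith)
  intro KM L hL _ hL2 𝒬 Cc hq hcard _ hCc hs
  have hM : (1 : ℝ) ≤ 2 ^ KM := one_le_pow₀ one_le_two
  have htot : ∀ k, 0 ≤ ∑' q : 𝒬, Cc k (q : ℤ × ℤ) := fun k => tsum_nonneg fun q => hCc k q
  refine tsum_le_of_sum_le' ?_ fun s => ?_
  · refine mul_nonneg (by positivity) (Finset.sum_nonneg fun k _ => ?_)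
    split_ifs
    · exact htot k
    · exact le_rfl
  rw [Finset.sum_comm, Finset.mul_sum]
  refine Finset.sum_le_sum fun k hk => ?_
  split_ifs with hkθ
  · refine sum_abs_Ffun_sub_EJ_le (hCc k) (hs k) (fun q hqm t => ?_) s
    refine (hmain (2 ^ k) L (by positivity) hL q.1 q.2 (hq q hqm) t).trans ?_
    have hkM : (2 : ℝ) ^ k ≤ 2 ^ KM :=
      pow_le_pow_right₀ one_le_two (Nat.lt_succ_iff.1 (Finset.mem_range.1 hk))
    have := error_terms_le hM hα₁ (by linarith : 0 < θ) hkθ hkM (hcard q hqm) hL2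
    push_cast
    calc _ ≤ C * (4 * ((2 : ℝ) ^ KM) ^ (-(min ε θ))) := by gcongr
      _ = _ := by ring
  · simp
end

section
/- (Menshov-type maximal estimate) Let d ≥ 1, D = 2^d, and let a_1, …, a_D be real numbers. Then max_{1 ≤ i ≤ D} |Σ_{1 ≤ j ≤ i} a_j|² ≤ (d+1) · Σ_{k=0}^{d} Σ_{s=0}^{2^{d−k}−1} |Σ_{j = 2^k·s + 1}^{2^k·(s+1)} a_j|². -/
open scoped BigOperators

/-- A sum over a block is a difference of two initial sums. -/
theorem sum_Icc_add_one_eq_sub (a : ℕ → ℝ) {m n : ℕ} (h : m ≤ n) :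
    ∑ j ∈ Finset.Icc (m + 1) n, a j =
      ∑ j ∈ Finset.Icc 1 n, a j - ∑ j ∈ Finset.Icc 1 m, a j := by
  have key := Finset.sum_Ioc_consecutive a (Nat.zero_le m) h
  simp only [← Finset.Icc_add_one_left_eq_Ioc, zero_add] at key
  linarith

/-- Rounding `i` down to multiples of `2 ^ k` and of `2 ^ (k + 1)` gives initial sums that differ
by at most one dyadic block of length `2 ^ k`. -/
theorem sq_sub_le_sum_dyadic_blocks (d : ℕ) (a : ℕ → ℝ) {i k : ℕ} (hi : i ≤ 2 ^ d) (hk : k ≤ d) :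
    (∑ j ∈ Finset.Icc 1 (2 ^ k * (i / 2 ^ k)), a j -
        ∑ j ∈ Finset.Icc 1 (2 ^ (k + 1) * (i / 2 ^ (k + 1))), a j) ^ 2 ≤
      ∑ s ∈ Finset.range (2 ^ (d - k)),
        |∑ j ∈ Finset.Icc (2 ^ k * s + 1) (2 ^ k * (s + 1)), a j| ^ 2 := by
  have hq : i / 2 ^ k ≤ 2 ^ (d - k) := by
    rw [← Nat.pow_div hk two_pos]
    exact Nat.div_le_div_right hi
  have hdiv : 2 ^ (k + 1) * (i / 2 ^ (k + 1)) = 2 ^ k * (2 * (i / 2 ^ k / 2)) := by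
    rw [Nat.div_div_eq_div_mul, ← pow_succ, pow_succ, mul_assoc]
  rw [hdiv]
  generalize i / 2 ^ k = q at hq
  obtain ⟨t, rfl | rfl⟩ := Nat.even_or_odd' q
  · rw [Nat.mul_div_cancel_left t two_pos, sub_self, zero_pow two_ne_zero]
    exact Finset.sum_nonneg fun _ _ => sq_nonneg _
  · have hle : 2 ^ k * (2 * t) ≤ 2 ^ k * (2 * t + 1) := by gcongr; omega
    rw [show (2 * t + 1) / 2 = t by omega, ← sum_Icc_add_one_eq_sub a hle, ← sq_abs]
    exact Finset.single_le_sum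
      (f := fun s => |∑ j ∈ Finset.Icc (2 ^ k * s + 1) (2 ^ k * (s + 1)), a j| ^ 2)
      (fun _ _ => sq_nonneg _) (Finset.mem_range.2 hq)

/-- Menshov-type maximal estimate: for `D = 2^d` and reals `a_1, …, a_D`,
`max_{1 ≤ i ≤ D} |Σ_{1 ≤ j ≤ i} a_j|² ≤ (d+1) Σ_{k=0}^{d} Σ_{s=0}^{2^{d−k}−1}
|Σ_{j=2^k s+1}^{2^k(s+1)} a_j|²`. -/
theorem menshov_maximal_estimate (d : ℕ) (hd : 1 ≤ d) (a : ℕ → ℝ) :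
    ∀ i : ℕ, 1 ≤ i → i ≤ 2 ^ d →
      |∑ j ∈ Finset.Icc 1 i, a j| ^ 2 ≤
        ((d : ℝ) + 1) *
          ∑ k ∈ Finset.range (d + 1), ∑ s ∈ Finset.range (2 ^ (d - k)),
            |∑ j ∈ Finset.Icc (2 ^ k * s + 1) (2 ^ k * (s + 1)), a j| ^ 2 := by
  intro i _ hi
  have hlt : i < 2 ^ (d + 1) := hi.trans_lt (Nat.pow_lt_pow_right one_lt_two d.lt_succ_self)
  have telescope := Finset.sum_range_sub'
    (fun k => ∑ j ∈ Finset.Icc 1 (2 ^ k * (i / 2 ^ k)), a j) (d + 1)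
  simp only [Nat.div_eq_of_lt hlt, pow_zero, Nat.div_one, one_mul, mul_zero,
    Finset.Icc_eq_empty_of_lt zero_lt_one, Finset.sum_empty, sub_zero] at telescope
  rw [sq_abs, ← telescope]
  refine sq_sum_le_card_mul_sum_sq.trans ?_
  rw [Finset.card_range, Nat.cast_add_one]
  gcongr with k hk
  exact sq_sub_le_sum_dyadic_blocks d a hi (Nat.lt_succ_iff.1 (Finset.mem_range.1 hk))
end

section
/- There is a constant C > 0 depending only on α and φ such that for every dyadic integer N and every x ∈ ℤ with x ≠ 0: |(μ_N∗μ̌_N)(x)| = |Σ_{y∈ℤ} μ_N(y)·μ_N(y−x)| ≤ C/N^α. -/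
open scoped BigOperators

/-- Telescoping two-sided bounds on increments. -/
lemma sub_bounds_of_increment_bounds (g : ℕ → ℝ) (J : ℕ) {e₁ e₂ : ℝ}
    (h : ∀ i, i + 1 < J → e₁ ≤ g (i + 1) - g i ∧ g (i + 1) - g i ≤ e₂) (i k : ℕ)
    (hk : i + k < J) : e₁ * k ≤ g (i + k) - g i ∧ g (i + k) - g i ≤ e₂ * k := by
  induction k with
  | zero => simp
  | succ k ih =>
    have h1 := ih (by omega)
    have h2 := h (i + k) (by omega)
    push_cast
    rw [← add_assoc]
    constructor <;> linarith [h1.1, h1.2, h2.1, h2.2]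

lemma card_le_of_forall_sub_le (s : Finset ℕ) {b : ℝ}
    (h : ∀ i ∈ s, ∀ j ∈ s, i ≤ j → ((j : ℝ) - i) ≤ b) : s.card ≤ ⌊b⌋₊ + 1 := by
  rcases s.eq_empty_or_nonempty with rfl | hs
  · simp
  · have hsub : s ⊆ Finset.Icc (s.min' hs) (s.min' hs + ⌊b⌋₊) := by
      intro j hj
      have h1 := s.min'_le j hj
      have h2 := h _ (s.min'_mem hs) j hj h1
      have h3 : j - s.min' hs ≤ ⌊b⌋₊ := Nat.le_floor (by push_cast [h1]; exact h2)
      exact Finset.mem_Icc.2 ⟨h1, by omega⟩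
    have := Finset.card_le_card hsub
    simp only [Nat.card_Icc] at this
    omega

lemma card_Icc_ceil_floor_le {a b : ℝ} (hab : a ≤ b) :
    ((Finset.Icc ⌈a⌉ ⌊b⌋).card : ℝ) ≤ b - a + 1 := by
  rw [Int.card_Icc]
  have h1 := Int.le_ceil a
  have h2 := Int.floor_le b
  rcases le_total 0 (⌊b⌋ + 1 - ⌈a⌉) with h | h
  · have : (((⌊b⌋ + 1 - ⌈a⌉).toNat : ℤ) : ℝ) = ((⌊b⌋ + 1 - ⌈a⌉ : ℤ) : ℝ) := by
      rw [Int.toNat_of_nonneg h]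
    rw [Int.cast_natCast] at this
    rw [this]
    push_cast
    linarith
  · rw [Int.toNat_of_nonpos h]
    simp only [Nat.cast_zero]
    linarith

/-- A sequence with increments in `[e₁, e₂]` is rarely close to an integer. -/
lemma card_near_int_le (g : ℕ → ℝ) (J : ℕ) {e₁ e₂ δ : ℝ} (he₁ : 0 < e₁) (he₂ : 0 ≤ e₂)
    (hδ : 0 ≤ δ)
    (h : ∀ i, i + 1 < J → e₁ ≤ g (i + 1) - g i ∧ g (i + 1) - g i ≤ e₂) :
    (((Finset.range J).filter fun i => |g i - round (g i)| ≤ δ).card : ℝ)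
      ≤ (J * e₂ + 2 * δ + 1) * (2 * δ / e₁ + 1) := by
  rcases Nat.eq_zero_or_pos J with rfl | hJ
  · simp only [Finset.range_zero, Finset.filter_empty, Finset.card_empty, Nat.cast_zero]
    positivity
  set S := (Finset.range J).filter fun i => |g i - round (g i)| ≤ δ with hS
  set T := Finset.Icc ⌈g 0 - δ⌉ ⌊g (J - 1) + δ⌋ with hT
  have hinc := sub_bounds_of_increment_bounds g J h
  have hmaps : ∀ i ∈ S, round (g i) ∈ T := by
    intro i hi
    obtain ⟨hiJ, hi⟩ := Finset.mem_filter.1 hi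
    rw [Finset.mem_range] at hiJ
    have hi' := abs_le.1 hi
    have h0 := (hinc 0 i (by omega)).1
    have h1 := (hinc i (J - 1 - i) (by omega)).1
    rw [zero_add] at h0
    rw [show i + (J - 1 - i) = J - 1 by omega] at h1
    have h2 : 0 ≤ e₁ * (i : ℝ) := by positivity
    have h3 : 0 ≤ e₁ * ((J - 1 - i : ℕ) : ℝ) := by positivity
    rw [Finset.mem_Icc, Int.ceil_le, Int.le_floor]
    constructor <;> linarith
  have hfib : ∀ z ∈ T, (S.filter fun i => round (g i) = z).card ≤ ⌊2 * δ / e₁⌋₊ + 1 := by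
    intro z _
    refine card_le_of_forall_sub_le _ fun i hi j hj hij => ?_
    obtain ⟨hiS, hiz⟩ := Finset.mem_filter.1 hi
    obtain ⟨hjS, hjz⟩ := Finset.mem_filter.1 hj
    have hi1 := (Finset.mem_filter.1 hiS).2
    have hj1 := (Finset.mem_filter.1 hjS).2
    have hjJ := Finset.mem_range.1 (Finset.mem_filter.1 hjS).1
    rw [hiz] at hi1
    rw [hjz] at hj1
    have h1 := (hinc i (j - i) (by omega)).1
    rw [show i + (j - i) = j by omega] at h1
    push_cast [hij] at h1
    rw [le_div_iff₀ he₁]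
    linarith [abs_le.1 hi1, abs_le.1 hj1]
  have hcard := Finset.card_le_mul_card_image_of_maps_to hmaps _ hfib
  have hspan := (hinc 0 (J - 1) (by omega))
  rw [zero_add] at hspan
  have hspan1 : 0 ≤ e₁ * ((J - 1 : ℕ) : ℝ) := by positivity
  have hJ1 : ((J - 1 : ℕ) : ℝ) ≤ J := by exact_mod_cast Nat.sub_le J 1
  have hspan2 : e₂ * ((J - 1 : ℕ) : ℝ) ≤ J * e₂ := by nlinarith
  have hTcard : (T.card : ℝ) ≤ J * e₂ + 2 * δ + 1 := by
    have := card_Icc_ceil_floor_le (a := g 0 - δ) (b := g (J - 1) + δ) (by linarith [hspan.1])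
    rw [hT]
    linarith [hspan.2]
  have hfl : ((⌊2 * δ / e₁⌋₊ + 1 : ℕ) : ℝ) ≤ 2 * δ / e₁ + 1 := by
    push_cast
    linarith [Nat.floor_le (show 0 ≤ 2 * δ / e₁ by positivity)]
  calc (S.card : ℝ) ≤ ((⌊2 * δ / e₁⌋₊ + 1) * T.card : ℕ) := by exact_mod_cast hcard
    _ = ((⌊2 * δ / e₁⌋₊ + 1 : ℕ) : ℝ) * T.card := by push_cast; ring
    _ ≤ (2 * δ / e₁ + 1) * (J * e₂ + 2 * δ + 1) := by gcongr
    _ = _ := by ring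

lemma abs_neg_sub_round_neg_le {y δ : ℝ} (h : |y - round y| ≤ δ) : |-y - round (-y)| ≤ δ := by
  refine (round_le (-y) (-round y)).trans ?_
  rw [Int.cast_neg, neg_sub_neg, abs_sub_comm]
  exact h

/-- `card_near_int_le` for increments close to a nonzero constant `c` of either sign. -/
lemma card_near_int_le' (g : ℕ → ℝ) (J : ℕ) {e₁ e₂ δ c : ℝ} (he₁ : 0 < e₁) (he₂ : 0 ≤ e₂)
    (hδ : 0 ≤ δ) (h1 : e₁ ≤ |c| / 2) (h2 : 3 * |c| / 2 ≤ e₂)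
    (h : ∀ i, i + 1 < J → |g (i + 1) - g i - c| ≤ |c| / 2) :
    (((Finset.range J).filter fun i => |g i - round (g i)| ≤ δ).card : ℝ)
      ≤ (J * e₂ + 2 * δ + 1) * (2 * δ / e₁ + 1) := by
  rcases le_total 0 c with hc | hc
  · rw [abs_of_nonneg hc] at *
    refine card_near_int_le g J he₁ he₂ hδ fun i hi => ?_
    have := abs_le.1 (h i hi)
    constructor <;> linarith
  · rw [abs_of_nonpos hc] at *
    refine le_trans ?_ (card_near_int_le (fun i => -g i) J he₁ he₂ hδ fun i hi => ?_)
    · exact_mod_cast Finset.card_le_card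
        (Finset.monotone_filter_right _ fun i _ hi => abs_neg_sub_round_neg_le hi)
    · have := abs_le.1 (h i hi)
      constructor <;> linarith

/-- On a short block whose slope is Diophantine, `f` is rarely close to an integer. -/
lemma card_near_int_block_le (f : ℕ → ℝ) (m₀ H D : ℕ) {δ η κ : ℝ} (hD : 1 ≤ D) (hDH : D ≤ H)
    (hδ : 0 ≤ δ) (hδ1 : δ ≤ 1) (hη : 0 < η)
    (hθ : ∀ k < 2 * H, |(f (m₀ + k + 1) - f (m₀ + k)) - (f (m₀ + 1) - f m₀)| ≤ κ)
    (hκ : D * κ ≤ η / 2)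
    (hgood : ∀ q : ℕ, 1 ≤ q → q ≤ D →
      η ≤ |q * (f (m₀ + 1) - f m₀) - round (q * (f (m₀ + 1) - f m₀))|) :
    (((Finset.range H).filter fun i => |f (m₀ + i) - round (f (m₀ + i))| ≤ δ).card : ℝ)
      ≤ 12 * H * δ + 3 * H / D + 12 * D * δ / η + 3 * D := by
  set θ := f (m₀ + 1) - f m₀ with hθdef
  obtain ⟨a, ha0, haD, ha⟩ := Real.exists_nat_abs_mul_sub_round_le θ (show 0 < D by omega)
  have hgooda := hgood a ha0 haD
  set p : ℤ := round (a * θ) with hp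
  set c : ℝ := a * θ - p with hc
  have hκ0 : 0 ≤ κ := (abs_nonneg _).trans (hθ 0 (by omega))
  have hcpos : 0 < |c| := hη.trans_le hgooda
  have haR : (0 : ℝ) < a := by exact_mod_cast ha0
  have haDR : (a : ℝ) ≤ D := by exact_mod_cast haD
  have hDR : (0 : ℝ) < D := haR.trans_le haDR
  have hHR : (D : ℝ) ≤ H := by exact_mod_cast hDH
  set J := H / a + 1 with hJ
  set S := (Finset.range H).filter fun i => |f (m₀ + i) - round (f (m₀ + i))| ≤ δ with hS
  set b : ℝ := (J * (3 * |c| / 2) + 2 * δ + 1) * (2 * δ / (|c| / 2) + 1) with hb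
  have hfib : ∀ r ∈ Finset.range a, ((S.filter fun i => i % a = r).card : ℝ) ≤ b := by
    intro r hr
    rw [Finset.mem_range] at hr
    let g : ℕ → ℝ := fun k => f (m₀ + r + k * a) - ((k * p : ℤ) : ℝ)
    have hg : ∀ k, |g k - round (g k)|
        = |f (m₀ + r + k * a) - round (f (m₀ + r + k * a))| := by
      intro k
      simp only [g]
      rw [round_sub_intCast, Int.cast_sub]
      congr 1
      ring
    refine le_trans ?_ (card_near_int_le' g J (c := c) (δ := δ) (e₁ := |c| / 2)
      (e₂ := 3 * |c| / 2) (by positivity) (by positivity) hδ le_rfl le_rfl ?_)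
    · have : (S.filter fun i => i % a = r).card ≤
          ((Finset.range J).filter fun i => |g i - round (g i)| ≤ δ).card := by
        refine Finset.card_le_card_of_injOn (fun i => i / a) ?_ ?_
        · intro i hi
          simp only [hS, Finset.coe_filter, Finset.mem_filter, Finset.mem_range,
            Set.mem_ofPred_eq] at hi ⊢
          obtain ⟨⟨hiH, hin⟩, hir⟩ := hi
          refine ⟨Nat.lt_succ_of_le (Nat.div_le_div_right hiH.le), ?_⟩
          rw [hg]
          have : m₀ + r + i / a * a = m₀ + i := by
            rw [← hir, add_assoc, mul_comm, Nat.mod_add_div]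
          rwa [this]
        · intro i hi j hj hij
          simp only [Finset.coe_filter, Set.mem_ofPred_eq] at hi hj hij
          rw [← Nat.mod_add_div i a, ← Nat.mod_add_div j a, hi.2, hj.2, hij]
      exact_mod_cast this
    · intro k hk
      have hka : (k + 1) * a ≤ H := by
        have : k + 1 ≤ H / a := by omega
        exact (Nat.mul_le_mul_right a this).trans (Nat.div_mul_le_self H a)
      have hka' : k * a + a ≤ H := by linarith
      have hstep := sub_bounds_of_increment_bounds (fun s => f (m₀ + r + k * a + s)) (a + 1)
        (e₁ := θ - κ) (e₂ := θ + κ) (fun i hi => by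
          have := abs_le.1 (hθ (r + k * a + i) (by omega))
          simp only [← add_assoc] at this ⊢
          constructor <;> linarith) 0 a (by omega)
      simp only [zero_add, add_zero] at hstep
      have hgk : g (k + 1) - g k - c
          = f (m₀ + r + k * a + a) - f (m₀ + r + k * a) - a * θ := by
        simp only [g, hc]
        rw [show m₀ + r + (k + 1) * a = m₀ + r + k * a + a by ring]
        push_cast
        ring
      have haκ : a * κ ≤ D * κ := by gcongr
      rw [hgk, abs_le]
      constructor <;> linarith [hstep.1, hstep.2]
  have hsum : (S.card : ℝ) ≤ a * b := by
    have := Finset.card_eq_sum_card_fiberwise (f := fun i => i % a) (s := S)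
      (t := Finset.range a) (fun i _ => by simpa using Nat.mod_lt i ha0)
    rw [this]
    push_cast
    refine (Finset.sum_le_sum hfib).trans ?_
    simp
  refine hsum.trans ?_
  have hJa : (a : ℝ) * J ≤ 2 * H := by
    have : a * J ≤ 2 * H := by
      rw [hJ]
      have := Nat.mul_div_le H a
      nlinarith
    exact_mod_cast this
  have hcD : |c| ≤ 1 / D := ha.trans (by gcongr; linarith)
  have h1 : a * b = ((a * J) * (3 * |c| / 2) + a * (2 * δ + 1)) * (4 * δ / |c| + 1) := by
    rw [hb]
    field_simp
    ring
  have h2 : (a * J) * (3 * |c| / 2) + a * (2 * δ + 1) ≤ 3 * H * |c| + 3 * a := by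
    have : (a : ℝ) * J * (3 * |c| / 2) ≤ 2 * H * (3 * |c| / 2) := by gcongr
    nlinarith
  have h3 : (3 * H * |c| + 3 * a) * (4 * δ / |c| + 1)
      = 12 * H * δ + 3 * H * |c| + 12 * a * δ / |c| + 3 * a := by
    field_simp
    ring
  have h4 : 3 * H * |c| ≤ 3 * H / D := by
    calc 3 * H * |c| ≤ 3 * H * (1 / D) := by gcongr
      _ = _ := by ring
  have h5 : 12 * a * δ / |c| ≤ 12 * D * δ / η := by gcongr
  calc a * b ≤ (3 * H * |c| + 3 * a) * (4 * δ / |c| + 1) := by rw [h1]; gcongr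
    _ ≤ _ := by rw [h3]; linarith

open Classical in
/-- Few blocks have a slope that is close to a rational with small denominator. -/
lemma card_bad_slope_le (ψ : ℕ → ℝ) (B D : ℕ) {e₁ e₂ η : ℝ} (he₁ : 0 < e₁) (he : e₁ ≤ e₂)
    (hη : 0 ≤ η) (h : ∀ i, i + 1 < B → e₁ ≤ ψ (i + 1) - ψ i ∧ ψ (i + 1) - ψ i ≤ e₂) :
    (((Finset.range B).filter fun j =>
        ∃ q ∈ Finset.Icc 1 D, |q * ψ j - round (q * ψ j)| ≤ η).card : ℝ)
      ≤ D * ((B * (D * e₂) + 2 * η + 1) * (2 * η / e₁ + 1)) := by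
  have hsub : ((Finset.range B).filter fun j =>
        ∃ q ∈ Finset.Icc 1 D, |q * ψ j - round (q * ψ j)| ≤ η) ⊆
      (Finset.Icc 1 D).biUnion fun q =>
        (Finset.range B).filter fun j => |q * ψ j - round (q * ψ j)| ≤ η := by
    intro j hj
    simp only [Finset.mem_filter, Finset.mem_biUnion] at hj ⊢
    obtain ⟨hj, q, hq, hqj⟩ := hj
    exact ⟨q, hq, hj, hqj⟩
  have hcard := (Finset.card_le_card hsub).trans Finset.card_biUnion_le
  have hq : ∀ q ∈ Finset.Icc 1 D,
      (((Finset.range B).filter fun j => |q * ψ j - round (q * ψ j)| ≤ η).card : ℝ)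
        ≤ (B * (D * e₂) + 2 * η + 1) * (2 * η / e₁ + 1) := by
    intro q hq
    obtain ⟨hq1, hqD⟩ := Finset.mem_Icc.1 hq
    have hq1 : (1 : ℝ) ≤ q := by exact_mod_cast hq1
    have hqD : (q : ℝ) ≤ D := by exact_mod_cast hqD
    have he₂ : 0 < e₂ := he₁.trans_le he
    refine card_near_int_le (fun j => q * ψ j) B he₁ (by positivity) hη fun i hi => ?_
    obtain ⟨h1, h2⟩ := h i hi
    rw [← mul_sub]
    constructor
    · nlinarith
    · calc q * (ψ (i + 1) - ψ i) ≤ q * e₂ := by gcongr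
        _ ≤ D * e₂ := by gcongr
  calc _ ≤ ((∑ q ∈ Finset.Icc 1 D,
        ((Finset.range B).filter fun j => |q * ψ j - round (q * ψ j)| ≤ η).card : ℕ) : ℝ) := by
        exact_mod_cast hcard
    _ ≤ _ := by
        push_cast
        refine (Finset.sum_le_sum hq).trans ?_
        simp

/-- Integers at which a sequence with small positive second differences is close to an integer. -/
lemma card_near_int_of_second_diff (f : ℕ → ℝ) (B H D : ℕ) {δ η ℓ Λ : ℝ} (hD : 1 ≤ D)
    (hDH : D ≤ H) (hδ : 0 ≤ δ) (hδ1 : δ ≤ 1) (hη : 0 < η) (hℓ : 0 < ℓ) (hℓΛ : ℓ ≤ Λ)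
    (hf : ∀ m < (B + 1) * H, ℓ ≤ (f (m + 1 + 1) - f (m + 1)) - (f (m + 1) - f m) ∧
      (f (m + 1 + 1) - f (m + 1)) - (f (m + 1) - f m) ≤ Λ)
    (hκ : D * (2 * H * Λ) ≤ η / 2) :
    (((Finset.range (B * H)).filter fun m => |f m - round (f m)| ≤ δ).card : ℝ)
      ≤ B * (12 * H * δ + 3 * H / D + 12 * D * δ / η + 3 * D)
        + H * (D * ((B * (D * (H * Λ)) + 2 * η + 1) * (2 * η / (H * ℓ) + 1))) := by
  classical
  have hH : 0 < H := by omega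
  have hHR : (0 : ℝ) < H := by exact_mod_cast hH
  have hΛ : 0 < Λ := hℓ.trans_le hℓΛ
  set S := (Finset.range (B * H)).filter fun m => |f m - round (f m)| ≤ δ with hS
  set θ : ℕ → ℝ := fun m => f (m + 1) - f m with hθ
  set ψ : ℕ → ℝ := fun j => θ (j * H) with hψ
  set G : ℝ := 12 * H * δ + 3 * H / D + 12 * D * δ / η + 3 * D with hG
  have hG0 : 0 ≤ G := by positivity
  have hinc := sub_bounds_of_increment_bounds θ ((B + 1) * H + 1) (e₁ := ℓ) (e₂ := Λ)
    (fun i hi => hf i (by omega))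
  have hbad := card_bad_slope_le ψ B D (e₁ := H * ℓ) (e₂ := H * Λ) (by positivity)
    (by gcongr) hη.le (fun i hi => by
      have hle : (i + 1) * H ≤ (B + 1) * H := Nat.mul_le_mul_right H (by omega)
      have := hinc (i * H) H (by linarith)
      simp only [hψ]
      rw [show (i + 1) * H = i * H + H by ring]
      constructor <;> linarith [this.1, this.2])
  set P : ℕ → Prop := fun j => ∃ q ∈ Finset.Icc 1 D, |q * ψ j - round (q * ψ j)| ≤ η with hP
  have hfib : ∀ j ∈ Finset.range B,
      ((S.filter fun m => m / H = j).card : ℝ) ≤ G + if P j then (H : ℝ) else 0 := by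
    intro j hj
    rw [Finset.mem_range] at hj
    have hinj : Set.InjOn (fun m => m % H) (S.filter fun m => m / H = j : Finset ℕ) := by
      intro m hm m' hm' hmm
      simp only [Finset.coe_filter, Set.mem_ofPred_eq] at hm hm' hmm
      rw [← Nat.mod_add_div m H, ← Nat.mod_add_div m' H, hm.2, hm'.2, hmm]
    split_ifs with hPj
    · have : (S.filter fun m => m / H = j).card ≤ (Finset.range H).card :=
        Finset.card_le_card_of_injOn _ (fun m _ => by simpa using Nat.mod_lt m hH) hinj
      rw [Finset.card_range] at this
      have : ((S.filter fun m => m / H = j).card : ℝ) ≤ H := by exact_mod_cast this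
      linarith
    · have hsub : (S.filter fun m => m / H = j).card ≤ ((Finset.range H).filter fun i =>
          |f (j * H + i) - round (f (j * H + i))| ≤ δ).card := by
        refine Finset.card_le_card_of_injOn _ (fun m hm => ?_) hinj
        simp only [hS, Finset.coe_filter, Finset.mem_filter, Finset.mem_range,
          Set.mem_ofPred_eq] at hm ⊢
        refine ⟨Nat.mod_lt m hH, ?_⟩
        have : j * H + m % H = m := by rw [← hm.2, add_comm, mul_comm, Nat.mod_add_div]
        rw [this]
        exact hm.1.2
      have hblock := card_near_int_block_le f (j * H) H D (δ := δ) (η := η) (κ := 2 * H * Λ)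
        hD hDH hδ hδ1 hη (fun k hk => by
          have hle : (j + 2) * H ≤ (B + 1) * H := Nat.mul_le_mul_right H (by omega)
          have hle' : j * H + k < (B + 1) * H + 1 := by linarith
          have h1 := hinc (j * H) k hle'
          have hkR : (k : ℝ) ≤ 2 * H := by exact_mod_cast hk.le
          have h2 : Λ * k ≤ Λ * (2 * H) := by gcongr
          have h3 : 0 ≤ ℓ * (k : ℝ) := by positivity
          simp only [hθ] at h1
          rw [abs_le]
          constructor <;> linarith [h1.1, h1.2]) hκ (fun q hq hqD => by
          by_contra hlt
          exact hPj ⟨q, Finset.mem_Icc.2 ⟨hq, hqD⟩, (not_le.1 hlt).le⟩)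
      have : ((S.filter fun m => m / H = j).card : ℝ) ≤ _ := (Nat.cast_le.2 hsub).trans hblock
      simpa using this
  have hsum := Finset.card_eq_sum_card_fiberwise (f := fun m => m / H) (s := S)
      (t := Finset.range B) (fun m hm => by
        have hm := (Finset.mem_filter.1 hm).1
        rw [Finset.mem_range] at hm
        simpa using (Nat.div_lt_iff_lt_mul hH).2 hm)
  rw [hsum]
  push_cast
  refine (Finset.sum_le_sum hfib).trans ?_
  rw [Finset.sum_add_distrib, Finset.sum_const, Finset.card_range, nsmul_eq_mul,
    ← Finset.sum_filter, Finset.sum_const, nsmul_eq_mul, mul_comm (Finset.card _ : ℝ)]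
  gcongr
  refine le_trans (le_of_eq ?_) hbad
  congr!

/-- The curve `t ↦ (x + t^α)^{1/α}`, i.e. the solution `s` of `s^α - t^α = x`. -/
noncomputable def shiftedRoot (α x t : ℝ) : ℝ := (x + t ^ α) ^ (1 / α)

lemma shiftedRoot_rpow {α x t : ℝ} (hα : 1 < α) (hx : 0 ≤ x) (ht : 0 < t) :
    shiftedRoot α x t ^ α = x + t ^ α := by
  have := Real.rpow_pos_of_pos ht α
  rw [shiftedRoot, ← Real.rpow_mul (by positivity), one_div, inv_mul_cancel₀ (by linarith),
    Real.rpow_one]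

lemma le_shiftedRoot {α x t : ℝ} (hα : 1 < α) (hx : 0 ≤ x) (ht : 0 < t) :
    t ≤ shiftedRoot α x t := by
  have := Real.rpow_pos_of_pos ht α
  refine (Real.rpow_le_rpow_iff ht.le (Real.rpow_nonneg (by positivity) _)
    (by linarith : (0 : ℝ) < α)).1 ?_
  change t ^ α ≤ shiftedRoot α x t ^ α
  rw [shiftedRoot_rpow hα hx ht]
  linarith

lemma hasDerivAt_shiftedRoot {α x t : ℝ} (hα : 1 < α) (hx : 0 ≤ x) (ht : 0 < t) :
    HasDerivAt (shiftedRoot α x) (t ^ (α - 1) * (x + t ^ α) ^ (1 / α - 1)) t := by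
  have hpos := Real.rpow_pos_of_pos ht α
  have h1 : HasDerivAt (fun s : ℝ => x + s ^ α) (α * t ^ (α - 1)) t :=
    (Real.hasDerivAt_rpow_const (Or.inl ht.ne')).const_add x
  have h2 := h1.rpow_const (p := 1 / α) (Or.inl (by positivity))
  refine h2.congr_deriv ?_
  field_simp

lemma hasDerivAt_deriv_shiftedRoot {α x t : ℝ} (hα : 1 < α) (hx : 0 ≤ x) (ht : 0 < t) :
    HasDerivAt (fun s : ℝ => s ^ (α - 1) * (x + s ^ α) ^ (1 / α - 1))
      ((α - 1) * x * t ^ (α - 2) * (x + t ^ α) ^ (1 / α - 2)) t := by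
  have hpos := Real.rpow_pos_of_pos ht α
  have h1 : HasDerivAt (fun s : ℝ => x + s ^ α) (α * t ^ (α - 1)) t :=
    (Real.hasDerivAt_rpow_const (Or.inl ht.ne')).const_add x
  have h2 := h1.rpow_const (p := 1 / α - 1) (Or.inl (by positivity))
  have h3 := (Real.hasDerivAt_rpow_const (p := α - 1) (Or.inl ht.ne')).mul h2
  refine h3.congr_deriv ?_
  have hS : (x + t ^ α) ^ (1 / α - 1) = (x + t ^ α) ^ (1 / α - 2) * (x + t ^ α) := by
    rw [← Real.rpow_add_one (by positivity)]
    congr 1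
    ring
  have ht1 : t ^ (α - 1) * t ^ (α - 1) = t ^ (α - 2) * t ^ α := by
    rw [← Real.rpow_add ht, ← Real.rpow_add ht]
    congr 1
    ring
  rw [show α - 1 - 1 = α - 2 by ring, show 1 / α - 1 - 1 = 1 / α - 2 by ring, hS]
  have hα0 : α ≠ 0 := by linarith
  have : t ^ (α - 1) * (α * t ^ (α - 1) * (1 / α - 1) * (x + t ^ α) ^ (1 / α - 2))
      = t ^ (α - 2) * t ^ α * (1 - α) * (x + t ^ α) ^ (1 / α - 2) := by
    rw [← ht1]
    field_simp
  rw [this]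
  ring

lemma exists_deriv_eq_second_diff {F F' F'' : ℝ → ℝ} {t : ℝ}
    (h1 : ∀ s, t ≤ s → HasDerivAt F (F' s) s) (h2 : ∀ s, t ≤ s → HasDerivAt F' (F'' s) s) :
    ∃ ζ, t ≤ ζ ∧ ζ ≤ t + 2 ∧ (F (t + 1 + 1) - F (t + 1)) - (F (t + 1) - F t) = F'' ζ := by
  have hd : ∀ s, t ≤ s → HasDerivAt (fun s => F (s + 1) - F s) (F' (s + 1) - F' s) s :=
    fun s hs => ((h1 (s + 1) (by linarith)).comp_add_const s 1).sub (h1 s hs)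
  obtain ⟨ξ, hξ, hξe⟩ := exists_hasDerivAt_eq_slope (fun s => F (s + 1) - F s)
    (fun s => F' (s + 1) - F' s) (show t < t + 1 by linarith)
    (fun s hs => (hd s hs.1).continuousAt.continuousWithinAt) (fun s hs => hd s hs.1.le)
  obtain ⟨ζ, hζ, hζe⟩ := exists_hasDerivAt_eq_slope F' F'' (show ξ < ξ + 1 by linarith)
    (fun s hs => (h2 s (by linarith [hs.1, hξ.1])).continuousAt.continuousWithinAt)
    (fun s hs => h2 s (by linarith [hs.1, hξ.1]))
  refine ⟨ζ, by linarith [hζ.1, hξ.1], by linarith [hζ.2, hξ.2], ?_⟩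
  rw [hζe]
  simp only [add_sub_cancel_left, div_one] at hξe ⊢
  exact hξe.symm

lemma rpow_le_sixty_four_mul {α N t : ℝ} (hα : 1 < α) (hα2 : α ≤ 2) (hN : 0 < N) (ht : 0 < t)
    (ht8 : t ≤ 8 * N) : t ^ α ≤ 64 * N ^ α := by
  calc t ^ α ≤ (8 * N) ^ α := by gcongr
    _ = 8 ^ α * N ^ α := Real.mul_rpow (by norm_num) hN.le
    _ ≤ 8 ^ (2 : ℝ) * N ^ α := by gcongr; norm_num
    _ = 64 * N ^ α := by norm_num

lemma second_deriv_bounds {α x N t : ℝ} (hα : 1 < α) (hα2 : α ≤ 2) (hx : 0 ≤ x) (hN : 0 < N)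
    (hxN : x ≤ 4 * N ^ α) (htN : N ≤ t) (ht8 : t ≤ 8 * N) :
    (α - 1) * x * N ^ (-1 - α) / 40000 ≤ (α - 1) * x * t ^ (α - 2) * (x + t ^ α) ^ (1 / α - 2) ∧
    (α - 1) * x * t ^ (α - 2) * (x + t ^ α) ^ (1 / α - 2) ≤ (α - 1) * x * N ^ (-1 - α) := by
  have ht : 0 < t := hN.trans_le htN
  have hNα := Real.rpow_pos_of_pos hN α
  have htα := Real.rpow_pos_of_pos ht α
  have hα1 : 0 ≤ α - 1 := by linarith
  have hinv : 1 / α ≤ 1 := by rw [div_le_one (by linarith)]; exact hα.le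
  have hinv0 : 0 < 1 / α := by positivity
  have hpow : N ^ (α - 2) * (N ^ α) ^ (1 / α - 2) = N ^ (-1 - α) := by
    rw [← Real.rpow_mul hN.le, ← Real.rpow_add hN]
    congr 1
    field_simp
    ring
  have hu1 : t ^ (α - 2) ≤ N ^ (α - 2) :=
    Real.rpow_le_rpow_of_nonpos hN htN (by linarith)
  have hu2 : (x + t ^ α) ^ (1 / α - 2) ≤ (N ^ α) ^ (1 / α - 2) := by
    refine Real.rpow_le_rpow_of_nonpos hNα ?_ (by linarith)
    have : N ^ α ≤ t ^ α := by gcongr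
    linarith
  have hl1 : N ^ (α - 2) / 8 ≤ t ^ (α - 2) := by
    calc N ^ (α - 2) / 8 = 8 ^ (-1 : ℝ) * N ^ (α - 2) := by
          rw [Real.rpow_neg_one]; ring
      _ ≤ 8 ^ (α - 2) * N ^ (α - 2) := by gcongr <;> [norm_num; linarith]
      _ = (8 * N) ^ (α - 2) := (Real.mul_rpow (by norm_num) hN.le).symm
      _ ≤ t ^ (α - 2) := Real.rpow_le_rpow_of_nonpos ht ht8 (by linarith)
  have hl2 : (N ^ α) ^ (1 / α - 2) / 5000 ≤ (x + t ^ α) ^ (1 / α - 2) := by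
    calc (N ^ α) ^ (1 / α - 2) / 5000 ≤ 68 ^ (-2 : ℝ) * (N ^ α) ^ (1 / α - 2) := by
          rw [Real.rpow_neg (by norm_num)]
          norm_num
          rw [div_eq_inv_mul]
          gcongr
          norm_num
      _ ≤ 68 ^ (1 / α - 2) * (N ^ α) ^ (1 / α - 2) := by gcongr <;> [norm_num; linarith]
      _ = (68 * N ^ α) ^ (1 / α - 2) := (Real.mul_rpow (by norm_num) hNα.le).symm
      _ ≤ (x + t ^ α) ^ (1 / α - 2) := by
          refine Real.rpow_le_rpow_of_nonpos (by positivity) ?_ (by linarith)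
          linarith [rpow_le_sixty_four_mul hα hα2 hN ht ht8]
  rw [← hpow]
  constructor
  · calc (α - 1) * x * (N ^ (α - 2) * (N ^ α) ^ (1 / α - 2)) / 40000
        = (α - 1) * x * (N ^ (α - 2) / 8) * ((N ^ α) ^ (1 / α - 2) / 5000) := by ring
      _ ≤ _ := by gcongr
  · rw [← mul_assoc]
    gcongr

lemma deriv_shiftedRoot_bounds {α x N t : ℝ} (hα : 1 < α) (hα2 : α ≤ 2) (hx : 0 ≤ x)
    (hN : 1 ≤ N) (hxN : x ≤ N) (htN : N ≤ t) (ht8 : t ≤ 8 * N) :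
    (1 - 1 / α) * (x / (128 * N ^ α)) ≤ 1 - t ^ (α - 1) * (x + t ^ α) ^ (1 / α - 1) ∧
    1 - t ^ (α - 1) * (x + t ^ α) ^ (1 / α - 1) ≤ (1 - 1 / α) * (x / N ^ α) := by
  have hN0 : 0 < N := by linarith
  have ht : 0 < t := by linarith
  have hNα := Real.rpow_pos_of_pos hN0 α
  have htα := Real.rpow_pos_of_pos ht α
  have hinv : 1 / α ≤ 1 := by rw [div_le_one (by linarith)]; exact hα.le
  have hinv0 : 0 < 1 / α := by positivity
  have hNt : N ^ α ≤ t ^ α := by gcongr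
  have ht64 := rpow_le_sixty_four_mul hα hα2 hN0 ht ht8
  set β := 1 - 1 / α with hβ
  have hβ0 : 0 ≤ β := by linarith
  set u := x / t ^ α with hu
  have hu0 : 0 ≤ u := by positivity
  have hu1 : u ≤ 1 := by
    rw [hu, div_le_one htα]
    calc x ≤ N := hxN
      _ = N ^ (1 : ℝ) := (Real.rpow_one N).symm
      _ ≤ N ^ α := Real.rpow_le_rpow_of_exponent_le hN hα.le
      _ ≤ t ^ α := hNt
  have hf : t ^ (α - 1) * (x + t ^ α) ^ (1 / α - 1) = ((1 + u) ^ β)⁻¹ := by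
    have h1 : x + t ^ α = t ^ α * (1 + u) := by rw [hu]; field_simp; ring
    rw [h1, Real.mul_rpow htα.le (by positivity), ← mul_assoc, ← Real.rpow_mul ht.le,
      ← Real.rpow_add ht, show α - 1 + α * (1 / α - 1) = 0 by field_simp; ring, Real.rpow_zero,
      one_mul, ← Real.rpow_neg (by positivity)]
    congr 1
    ring
  rw [hf]
  have hupos : 0 < (1 + u) ^ β := Real.rpow_pos_of_pos (by linarith) _
  constructor
  · have h1 : ((1 + u) ^ β)⁻¹ ≤ 1 + β * (-(u / (1 + u))) := by
      rw [← Real.inv_rpow (by linarith), show (1 + u)⁻¹ = 1 + -(u / (1 + u)) by field_simp; ring]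
      refine rpow_one_add_le_one_add_mul_self ?_ hβ0 (by linarith)
      rw [neg_le_neg_iff, div_le_one (by linarith)]
      linarith
    have h2 : x / (128 * N ^ α) ≤ u / (1 + u) := by
      calc x / (128 * N ^ α) ≤ x / (2 * t ^ α) :=
            div_le_div_of_nonneg_left hx (by positivity) (by linarith)
        _ = u / 2 := by rw [hu]; field_simp
        _ ≤ u / (1 + u) := by gcongr; linarith
    have h3 : β * (x / (128 * N ^ α)) ≤ β * (u / (1 + u)) := by gcongr
    linarith
  · have h1 : (1 + u) ^ β ≤ 1 + β * u :=
      rpow_one_add_le_one_add_mul_self (by linarith) hβ0 (by linarith)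
    have h2 : 1 - β * u ≤ ((1 + u) ^ β)⁻¹ := by
      calc 1 - β * u ≤ (1 + β * u)⁻¹ := by
            rw [← one_div, le_div_iff₀ (by positivity)]
            nlinarith [sq_nonneg (β * u)]
        _ ≤ _ := by gcongr
    have h3 : u ≤ x / N ^ α := by rw [hu]; gcongr
    have h4 : β * u ≤ β * (x / N ^ α) := by gcongr
    linarith

lemma abs_sub_mul_rpow_le {α N a b : ℝ} (hα : 1 < α) (hN : 0 < N) (ha : N ≤ a) (hb : N ≤ b) :
    |a - b| * N ^ (α - 1) ≤ |a ^ α - b ^ α| := by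
  wlog hab : b ≤ a generalizing a b
  · rw [abs_sub_comm, abs_sub_comm (a ^ α)]
    exact this hb ha (le_of_not_ge hab)
  have hb0 : 0 < b := by linarith
  have ha0 : 0 < a := by linarith
  rw [abs_of_nonneg (by linarith), abs_of_nonneg (sub_nonneg.2 (by gcongr))]
  have hsplit : ∀ c : ℝ, 0 < c → c ^ α = c ^ (α - 1) * c := fun c hc => by
    rw [← Real.rpow_add_one hc.ne', sub_add_cancel]
  have h1 : N ^ (α - 1) ≤ b ^ (α - 1) := Real.rpow_le_rpow hN.le hb (by linarith)
  have h2 : b ^ (α - 1) ≤ a ^ (α - 1) := Real.rpow_le_rpow hb0.le hab (by linarith)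
  rw [hsplit a ha0, hsplit b hb0]
  nlinarith

/-- Pairs in `[N, 2N]²` whose images under `m ↦ ⌊m^α⌋` differ by `x`. -/
noncomputable def floorPowPairs (α : ℝ) (N : ℕ) (x : ℤ) : Finset (ℕ × ℕ) :=
  (Finset.Icc N (2 * N) ×ˢ Finset.Icc N (2 * N)).filter
    fun p => ⌊(p.1 : ℝ) ^ α⌋ - ⌊(p.2 : ℝ) ^ α⌋ = x

lemma mem_floorPowPairs {α : ℝ} {N : ℕ} {x : ℤ} {p : ℕ × ℕ} :
    p ∈ floorPowPairs α N x ↔ ((N ≤ p.1 ∧ p.1 ≤ 2 * N) ∧ N ≤ p.2 ∧ p.2 ≤ 2 * N) ∧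
      ⌊(p.1 : ℝ) ^ α⌋ - ⌊(p.2 : ℝ) ^ α⌋ = x := by
  simp [floorPowPairs]

lemma abs_sub_shiftedRoot_le {α : ℝ} (hα : 1 < α) {N : ℕ} (hN : 1 ≤ N) {x : ℤ} (hx : 1 ≤ x)
    {p : ℕ × ℕ} (hp : p ∈ floorPowPairs α N x) :
    |(p.1 : ℝ) - shiftedRoot α x p.2| ≤ (N : ℝ) ^ (1 - α) := by
  obtain ⟨⟨⟨h1, -⟩, h2, -⟩, h3⟩ := mem_floorPowPairs.1 hp
  have hN0 : (0 : ℝ) < N := by exact_mod_cast hN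
  have h1R : (N : ℝ) ≤ p.1 := by exact_mod_cast h1
  have h2R : (N : ℝ) ≤ p.2 := by exact_mod_cast h2
  have hxR : (0 : ℝ) ≤ x := by exact_mod_cast (by omega : 0 ≤ x)
  have h2pos : (0 : ℝ) < p.2 := hN0.trans_le h2R
  have hroot := le_shiftedRoot hα hxR h2pos
  have hmain := abs_sub_mul_rpow_le hα hN0 h1R (h2R.trans hroot)
  rw [shiftedRoot_rpow hα hxR h2pos] at hmain
  have hfl : |(p.1 : ℝ) ^ α - (x + (p.2 : ℝ) ^ α)| ≤ 1 := by
    have e : (⌊(p.1 : ℝ) ^ α⌋ : ℝ) - ⌊(p.2 : ℝ) ^ α⌋ = x := by exact_mod_cast h3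
    rw [abs_le]
    constructor <;> linarith [Int.floor_le ((p.1 : ℝ) ^ α), Int.lt_floor_add_one ((p.1 : ℝ) ^ α),
      Int.floor_le ((p.2 : ℝ) ^ α), Int.lt_floor_add_one ((p.2 : ℝ) ^ α)]
  have hs : 0 < (N : ℝ) ^ (α - 1) := Real.rpow_pos_of_pos hN0 _
  rw [show 1 - α = -(α - 1) by ring, Real.rpow_neg hN0.le, ← one_div, le_div_iff₀ hs]
  exact hmain.trans hfl

lemma card_floorPowPairs_le_near {α : ℝ} (hα : 1 < α) {N : ℕ} (hN : 1 ≤ N) {x : ℤ} (hx : 1 ≤ x)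
    (hδ : (N : ℝ) ^ (1 - α) < 1 / 2) :
    (floorPowPairs α N x).card ≤ ((Finset.range (N + 1)).filter fun i =>
      |shiftedRoot α x ((N + i : ℕ) : ℝ) - round (shiftedRoot α x ((N + i : ℕ) : ℝ))|
        ≤ (N : ℝ) ^ (1 - α)).card := by
  refine Finset.card_le_card_of_injOn (fun p => p.2 - N) (fun p hp => ?_) (fun p hp q hq hpq => ?_)
  · have hclose := abs_sub_shiftedRoot_le hα hN hx hp
    obtain ⟨⟨-, h2, h2'⟩, -⟩ := mem_floorPowPairs.1 hp
    simp only [Finset.coe_filter, Finset.mem_range, Set.mem_ofPred_eq]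
    refine ⟨by omega, ?_⟩
    rw [show N + (p.2 - N) = p.2 by omega]
    refine (round_le _ (p.1 : ℤ)).trans ?_
    rw [abs_sub_comm]
    exact_mod_cast hclose
  · have hp1 := abs_le.1 (abs_sub_shiftedRoot_le hα hN hx hp)
    have hq1 := abs_le.1 (abs_sub_shiftedRoot_le hα hN hx hq)
    obtain ⟨⟨-, h2, -⟩, -⟩ := mem_floorPowPairs.1 hp
    obtain ⟨⟨-, h2', -⟩, -⟩ := mem_floorPowPairs.1 hq
    simp only at hpq
    have he : p.2 = q.2 := by omega
    rw [he] at hp1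
    have h3 : (p.1 : ℝ) - q.1 < 1 := by linarith [hp1.2, hq1.1]
    have h4 : (q.1 : ℝ) - p.1 < 1 := by linarith [hq1.2, hp1.1]
    have h5 : p.1 < q.1 + 1 := by exact_mod_cast (by linarith : (p.1 : ℝ) < q.1 + 1)
    have h6 : q.1 < p.1 + 1 := by exact_mod_cast (by linarith : (q.1 : ℝ) < p.1 + 1)
    exact Prod.ext (by omega) he

lemma le_of_floorPowPairs_nonempty {α : ℝ} (hα : 1 < α) (hα2 : α ≤ 2) {N : ℕ} {x : ℤ}
    (h : (floorPowPairs α N x).Nonempty) : (x : ℝ) ≤ 4 * (N : ℝ) ^ α := by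
  obtain ⟨p, hp⟩ := h
  obtain ⟨⟨⟨-, h1⟩, -⟩, h3⟩ := mem_floorPowPairs.1 hp
  have h0 : (0 : ℤ) ≤ ⌊(p.2 : ℝ) ^ α⌋ := Int.floor_nonneg.2 (by positivity)
  have hxle : (x : ℝ) ≤ ⌊(p.1 : ℝ) ^ α⌋ := by exact_mod_cast (by omega)
  have h1R : (p.1 : ℝ) ≤ 2 * N := by exact_mod_cast h1
  calc (x : ℝ) ≤ (p.1 : ℝ) ^ α := hxle.trans (Int.floor_le _)
    _ ≤ (2 * N) ^ α := by gcongr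
    _ = 2 ^ α * (N : ℝ) ^ α := Real.mul_rpow (by norm_num) (by positivity)
    _ ≤ 2 ^ (2 : ℝ) * (N : ℝ) ^ α := by gcongr; norm_num
    _ = 4 * (N : ℝ) ^ α := by norm_num

lemma rpow_half_le_of_floorPowPairs_nonempty {α : ℝ} (hα : 1 < α) {N : ℕ} (hN : 1 ≤ N)
    {x : ℤ} (hx : 1 ≤ x) (hδ : (N : ℝ) ^ (1 - α) < 1 / 2)
    (h : (floorPowPairs α N x).Nonempty) : (N : ℝ) ^ (α - 1) / 2 ≤ x := by
  obtain ⟨p, hp⟩ := h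
  have hclose := abs_le.1 (abs_sub_shiftedRoot_le hα hN hx hp)
  obtain ⟨⟨⟨h1, -⟩, h2, -⟩, h3⟩ := mem_floorPowPairs.1 hp
  have hN0 : (0 : ℝ) < N := by exact_mod_cast hN
  have h2R : (N : ℝ) ≤ p.2 := by exact_mod_cast h2
  have hxR : (0 : ℝ) ≤ x := by exact_mod_cast (by omega : 0 ≤ x)
  have h2pos : (0 : ℝ) < p.2 := hN0.trans_le h2R
  have hlt : p.2 < p.1 := by
    by_contra hle
    have hle : (p.1 : ℝ) ≤ p.2 := by exact_mod_cast not_lt.1 hle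
    have : ⌊(p.1 : ℝ) ^ α⌋ ≤ ⌊(p.2 : ℝ) ^ α⌋ := Int.floor_mono (by gcongr)
    omega
  have hlt : (p.2 : ℝ) + 1 ≤ p.1 := by exact_mod_cast hlt
  have hroot := le_shiftedRoot hα hxR h2pos
  have hmain := abs_sub_mul_rpow_le hα hN0 (h2R.trans hroot) h2R
  rw [shiftedRoot_rpow hα hxR h2pos, add_sub_cancel_right, abs_of_nonneg hxR] at hmain
  have hs : 0 < (N : ℝ) ^ (α - 1) := Real.rpow_pos_of_pos hN0 _
  have : 1 / 2 ≤ |shiftedRoot α x p.2 - p.2| := by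
    refine le_trans ?_ (le_abs_self _)
    linarith [hclose.2]
  nlinarith

/-- Small shifts: `t ↦ shiftedRoot α x t - t` is monotone with controlled increments. -/
lemma card_near_shiftedRoot_of_le {α : ℝ} (hα : 1 < α) (hα2 : α ≤ 2) {N : ℕ} (hN : 1 ≤ N)
    {x : ℝ} (hxs : (N : ℝ) ^ (α - 1) / 2 ≤ x) (hxN : x ≤ N) :
    (((Finset.range (N + 1)).filter fun i =>
      |shiftedRoot α x ((N + i : ℕ) : ℝ) - round (shiftedRoot α x ((N + i : ℕ) : ℝ))|
        ≤ (N : ℝ) ^ (1 - α)).card : ℝ) ≤ (2048 / (1 - 1 / α) + 5) * (N : ℝ) ^ (2 - α) := by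
  have hN1 : (1 : ℝ) ≤ N := by exact_mod_cast hN
  have hN0 : (0 : ℝ) < N := by linarith
  set s := (N : ℝ) ^ (α - 1) with hs
  have hs1 : 1 ≤ s := Real.one_le_rpow hN1 (by linarith)
  have hsN : s ≤ N := by
    calc s ≤ (N : ℝ) ^ (1 : ℝ) := Real.rpow_le_rpow_of_exponent_le hN1 (by linarith)
      _ = N := Real.rpow_one _
  have hδ : (N : ℝ) ^ (1 - α) = 1 / s := by
    rw [show 1 - α = -(α - 1) by ring, Real.rpow_neg hN0.le, one_div]
  have hNα : (N : ℝ) ^ α = N * s := by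
    rw [hs, mul_comm, ← Real.rpow_add_one hN0.ne', sub_add_cancel]
  have hN2 : (N : ℝ) ^ (2 - α) = N / s := by
    rw [hs, show 2 - α = 1 - (α - 1) by ring, Real.rpow_sub hN0, Real.rpow_one]
  have hx0 : 0 < x := by linarith
  set β := 1 - 1 / α with hβ
  have hβ0 : 0 < β := by
    have : 1 / α < 1 := by rw [div_lt_one (by linarith)]; exact hα
    linarith
  have hβ1 : β ≤ 1 := by
    have : 0 < 1 / α := by positivity
    linarith
  let g : ℕ → ℝ := fun i => ((N + i : ℕ) : ℝ) - shiftedRoot α x ((N + i : ℕ) : ℝ)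
  have hg : ∀ i, i + 1 < N + 1 → β * (x / (128 * (N * s))) ≤ g (i + 1) - g i ∧
      g (i + 1) - g i ≤ β * (x / (N * s)) := by
    intro i hi
    have hiN : (i : ℝ) + 1 ≤ N := by exact_mod_cast (by omega : i + 1 ≤ N)
    have hi0 : (0 : ℝ) ≤ i := Nat.cast_nonneg i
    obtain ⟨ξ, hξ, hξe⟩ := exists_hasDerivAt_eq_slope (shiftedRoot α x)
      (fun t => t ^ (α - 1) * (x + t ^ α) ^ (1 / α - 1)) (show (N + i : ℝ) < N + i + 1 by linarith)
      (fun t ht => (hasDerivAt_shiftedRoot hα hx0.le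
        (by linarith [ht.1])).continuousAt.continuousWithinAt)
      (fun t ht => hasDerivAt_shiftedRoot hα hx0.le (by linarith [ht.1]))
    have hb := deriv_shiftedRoot_bounds hα hα2 hx0.le hN1 hxN (t := ξ) (by linarith [hξ.1])
      (by linarith [hξ.2])
    rw [hξe, add_sub_cancel_left, div_one, hNα] at hb
    simp only [g]
    push_cast
    rw [← add_assoc]
    constructor <;> linarith [hb.1, hb.2]
  have hcount := card_near_int_le g (N + 1) (e₁ := β * (x / (128 * (N * s))))
    (e₂ := β * (x / (N * s))) (δ := 1 / s) (by positivity) (by positivity) (by positivity) hg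
  have hsub : (((Finset.range (N + 1)).filter fun i =>
      |shiftedRoot α x ((N + i : ℕ) : ℝ) - round (shiftedRoot α x ((N + i : ℕ) : ℝ))|
        ≤ (N : ℝ) ^ (1 - α)).card : ℝ) ≤
      (((Finset.range (N + 1)).filter fun i => |g i - round (g i)| ≤ 1 / s).card : ℝ) := by
    rw [hδ]
    refine Nat.cast_le.2 (Finset.card_le_card (Finset.monotone_filter_right _ fun i _ hi => ?_))
    refine (round_le _ ((N + i : ℕ) - round (shiftedRoot α x ((N + i : ℕ) : ℝ)) : ℤ)).trans ?_
    simp only [g]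
    push_cast at hi ⊢
    rw [sub_sub_sub_cancel_left, abs_sub_comm]
    exact hi
  refine hsub.trans (hcount.trans ?_)
  rw [hN2]
  have h1 : ((N + 1 : ℕ) : ℝ) * (β * (x / (N * s))) + 2 * (1 / s) + 1 ≤ 2 * x / s + 3 := by
    have h2s : 2 * (1 / s) ≤ 2 := by
      have : 1 / s ≤ 1 := by rw [div_le_one (by linarith)]; exact hs1
      linarith
    have : ((N + 1 : ℕ) : ℝ) * (β * (x / (N * s))) ≤ (2 * N) * (1 * (x / (N * s))) := by
      gcongr
      push_cast
      linarith
    have h3 : (2 * N : ℝ) * (1 * (x / (N * s))) = 2 * x / s := by field_simp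
    linarith
  have h2 : 2 * (1 / s) / (β * (x / (128 * (N * s)))) + 1 = 256 * N / (β * x) + 1 := by
    field_simp
    ring
  rw [h2]
  have h3 : N / x ≤ 2 * (N / s) := by
    calc N / x ≤ N / (s / 2) := by gcongr
      _ = _ := by field_simp
  have h4 : x / s ≤ N / s := by gcongr
  have h5 : 1 ≤ N / s := by rw [one_le_div (by linarith)]; exact hsN
  calc (((N + 1 : ℕ) : ℝ) * (β * (x / (N * s))) + 2 * (1 / s) + 1) * (256 * N / (β * x) + 1)
      ≤ (2 * x / s + 3) * (256 * N / (β * x) + 1) := by gcongr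
    _ = 512 / β * (N / s) + 2 * (x / s) + 768 / β * (N / x) + 3 := by
        field_simp
        ring
    _ ≤ 512 / β * (N / s) + 2 * (N / s) + 768 / β * (2 * (N / s)) + 3 * (N / s) := by
        gcongr
        linarith
    _ = (2048 / β + 5) * (N / s) := by ring

lemma near_integer_parameter_bound {w s γ B H D Λ ℓ : ℝ} (hs : 1 ≤ s) (hsw : s ^ 4 ≤ w)
    (hHl : w ^ 2 ≤ H) (hHu : H ≤ 2 * w ^ 2) (hDl : s ≤ D) (hDu : D ≤ 2 * s) (hB : 0 ≤ B)
    (hBH : B * H ≤ 4 * w ^ 4) (hΛ0 : 0 ≤ Λ) (hΛ : Λ ≤ 1 / w ^ 4) (hγ : 0 < γ)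
    (hℓ : γ / (w ^ 4 * s) ≤ ℓ) :
    B * (12 * H * (1 / s) + 3 * H / D + 12 * D * (1 / s) / (1 / w) + 3 * D)
      + H * (D * ((B * (D * (H * Λ)) + 2 * (1 / w) + 1) * (2 * (1 / w) / (H * ℓ) + 1)))
      ≤ (180 + 44 * (2 / γ + 1)) * (w ^ 4 / s) := by
  have hs0 : 0 < s := by linarith
  have hsw1 : s ≤ w := (le_self_pow₀ hs (by norm_num)).trans hsw
  have hw1 : 1 ≤ w := hs.trans hsw1
  have hw : 0 < w := by linarith
  have hH : 0 < H := lt_of_lt_of_le (by positivity) hHl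
  have hD : 0 < D := by linarith
  have hℓ0 : 0 < ℓ := lt_of_lt_of_le (by positivity) hℓ
  have hBw : B ≤ 4 * w ^ 2 := by
    have h1 : B * w ^ 2 ≤ 4 * w ^ 2 * w ^ 2 := by
      calc B * w ^ 2 ≤ B * H := by gcongr
        _ ≤ 4 * w ^ 4 := hBH
        _ = _ := by ring
    exact le_of_mul_le_mul_right h1 (by positivity)
  have t1 : B * (12 * H * (1 / s)) ≤ 48 * (w ^ 4 / s) := by
    calc B * (12 * H * (1 / s)) = 12 * (B * H) / s := by ring
      _ ≤ 12 * (4 * w ^ 4) / s := by gcongr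
      _ = _ := by ring
  have t2 : B * (3 * H / D) ≤ 12 * (w ^ 4 / s) := by
    calc B * (3 * H / D) = 3 * (B * H) / D := by ring
      _ ≤ 3 * (4 * w ^ 4) / s := by gcongr
      _ = _ := by ring
  have hw3 : w ^ 3 ≤ w ^ 4 / s := by
    rw [le_div_iff₀ hs0]
    calc w ^ 3 * s ≤ w ^ 3 * w := by gcongr
      _ = _ := by ring
  have t3 : B * (12 * D * (1 / s) / (1 / w)) ≤ 96 * (w ^ 4 / s) := by
    calc B * (12 * D * (1 / s) / (1 / w)) = 12 * B * D * w / s := by field_simp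
      _ ≤ 12 * (4 * w ^ 2) * (2 * s) * w / s := by gcongr
      _ = 96 * w ^ 3 := by field_simp; ring
      _ ≤ _ := by gcongr
  have t4 : B * (3 * D) ≤ 24 * (w ^ 4 / s) := by
    calc B * (3 * D) ≤ 4 * w ^ 2 * (3 * (2 * s)) := by gcongr
      _ ≤ 4 * w ^ 2 * (3 * (2 * w)) := by gcongr
      _ = 24 * w ^ 3 := by ring
      _ ≤ _ := by gcongr
  have u1 : B * (D * (H * Λ)) + 2 * (1 / w) + 1 ≤ 11 * s := by
    have h1 : B * (D * (H * Λ)) ≤ 8 * s := by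
      calc B * (D * (H * Λ)) = (B * H) * D * Λ := by ring
        _ ≤ (4 * w ^ 4) * (2 * s) * (1 / w ^ 4) := by gcongr
        _ = 8 * s := by field_simp; ring
    have h2 : 1 / w ≤ 1 := by rw [div_le_one hw]; exact hw1
    linarith
  have u2 : 2 * (1 / w) / (H * ℓ) + 1 ≤ (2 / γ + 1) * (w * s) := by
    have h1 : 2 * (1 / w) / (H * ℓ) ≤ 2 / γ * (w * s) := by
      calc 2 * (1 / w) / (H * ℓ) ≤ 2 * (1 / w) / (w ^ 2 * (γ / (w ^ 4 * s))) := by gcongr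
        _ = 2 / γ * (w * s) := by field_simp
    have h2 : 1 ≤ w * s := by nlinarith
    linarith
  have t5 : H * (D * ((B * (D * (H * Λ)) + 2 * (1 / w) + 1) * (2 * (1 / w) / (H * ℓ) + 1)))
      ≤ 44 * (2 / γ + 1) * (w ^ 4 / s) := by
    have h1 : w ^ 3 * s ^ 3 ≤ w ^ 4 / s := by
      rw [le_div_iff₀ hs0]
      calc w ^ 3 * s ^ 3 * s = w ^ 3 * s ^ 4 := by ring
        _ ≤ w ^ 3 * w := by gcongr
        _ = _ := by ring
    calc _ ≤ (2 * w ^ 2) * ((2 * s) * ((11 * s) * ((2 / γ + 1) * (w * s)))) := by gcongr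
      _ = 44 * (2 / γ + 1) * (w ^ 3 * s ^ 3) := by ring
      _ ≤ _ := by gcongr
  calc _ = B * (12 * H * (1 / s)) + B * (3 * H / D) + B * (12 * D * (1 / s) / (1 / w))
        + B * (3 * D)
        + H * (D * ((B * (D * (H * Λ)) + 2 * (1 / w) + 1) * (2 * (1 / w) / (H * ℓ) + 1))) := by
        ring
    _ ≤ _ := by linarith

/-- Large shifts: the curve `shiftedRoot α x` is convex enough for the second difference bound. -/
lemma card_near_shiftedRoot_of_ge {α : ℝ} (hα : 1 < α) (hα2 : α ≤ 1 + 1 / 1000) {N : ℕ}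
    (hN : 2 ^ 32 ≤ N) {x : ℝ} (hNx : N ≤ x) (hxN : x ≤ 4 * (N : ℝ) ^ α) :
    (((Finset.range (N + 1)).filter fun i =>
      |shiftedRoot α x ((N + i : ℕ) : ℝ) - round (shiftedRoot α x ((N + i : ℕ) : ℝ))|
        ≤ (N : ℝ) ^ (1 - α)).card : ℝ)
      ≤ (180 + 44 * (2 / ((α - 1) / 40000) + 1)) * (N : ℝ) ^ (2 - α) := by
  have hNR : (2 : ℝ) ^ 32 ≤ N := by exact_mod_cast hN
  have hN0 : (0 : ℝ) < N := by linarith [show (0 : ℝ) < 2 ^ 32 by norm_num]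
  have hN1 : (1 : ℝ) ≤ N := by linarith [show (1 : ℝ) < 2 ^ 32 by norm_num]
  have hx0 : 0 < x := by linarith
  set s := (N : ℝ) ^ (α - 1) with hs
  set w := (N : ℝ) ^ (1 / 4 : ℝ) with hw
  have hs1 : 1 ≤ s := Real.one_le_rpow hN1 (by linarith)
  have hw4 : w ^ 4 = N := by
    rw [hw, ← Real.rpow_natCast, ← Real.rpow_mul hN0.le]
    norm_num
  have hw0 : 0 < w := Real.rpow_pos_of_pos hN0 _
  have hw256 : 256 ≤ w := by
    refine le_of_pow_le_pow_left₀ (n := 4) (by norm_num) hw0.le ?_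
    rw [hw4]
    refine le_trans (by norm_num) hNR
  have hsw : s ^ 4 ≤ w := by
    rw [hs, ← Real.rpow_natCast, ← Real.rpow_mul hN0.le]
    refine Real.rpow_le_rpow_of_exponent_le hN1 ?_
    push_cast
    linarith
  have hδ : (N : ℝ) ^ (1 - α) = 1 / s := by
    rw [show 1 - α = -(α - 1) by ring, Real.rpow_neg hN0.le, one_div]
  have hN2 : (N : ℝ) ^ (2 - α) = w ^ 4 / s := by
    rw [hw4, hs, show 2 - α = 1 - (α - 1) by ring, Real.rpow_sub hN0, Real.rpow_one]
  have hNα : (N : ℝ) ^ α = w ^ 4 * s := by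
    rw [hw4, hs, mul_comm, ← Real.rpow_add_one hN0.ne', sub_add_cancel]
  have hNα' : (N : ℝ) ^ (-1 - α) = 1 / (w ^ 4 * (w ^ 4 * s)) := by
    rw [← hNα, hw4, Real.rpow_sub hN0, Real.rpow_neg_one]
    field_simp
  rw [hδ, hN2]
  set D := ⌈s⌉₊ with hD
  set H := ⌈w ^ 2⌉₊ with hH
  set B := (N + 1) / H + 1 with hB
  have hDl : s ≤ D := Nat.le_ceil s
  have hDu : (D : ℝ) ≤ 2 * s := by linarith [Nat.ceil_lt_add_one (show 0 ≤ s by linarith)]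
  have hHl : w ^ 2 ≤ H := Nat.le_ceil _
  have hHu : (H : ℝ) ≤ 2 * w ^ 2 := by
    have := Nat.ceil_lt_add_one (show 0 ≤ w ^ 2 by positivity)
    nlinarith
  have h16 : 16 * s ≤ w := by
    refine le_of_pow_le_pow_left₀ (n := 2) (by norm_num) hw0.le ?_
    have : s ^ 2 ≤ s ^ 4 := pow_le_pow_right₀ hs1 (by norm_num)
    nlinarith
  have hD1 : 1 ≤ D := by exact_mod_cast hs1.trans hDl
  have hDH : D ≤ H := by
    have : (D : ℝ) ≤ H := by nlinarith
    exact_mod_cast this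
  have hHN : 2 * H ≤ N := by
    have : 2 * (H : ℝ) ≤ N := by
      rw [← hw4]
      nlinarith [pow_pos hw0 2, mul_le_mul hw256 hw256 (by norm_num) hw0.le]
    exact_mod_cast this
  have hBHl : N + 1 ≤ B * H := by
    have := Nat.lt_mul_div_succ (N + 1) (show 0 < H by omega)
    rw [hB, mul_comm]
    exact this.le
  have hBHu : B * H ≤ N + 1 + H := by
    have := Nat.div_mul_le_self (N + 1) H
    rw [hB, add_mul, one_mul]
    omega
  have hBHR : (B : ℝ) * H ≤ 4 * w ^ 4 := by
    rw [hw4]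
    have : B * H ≤ 4 * N := by omega
    exact_mod_cast this
  set Λ := (α - 1) * x * (N : ℝ) ^ (-1 - α) with hΛ
  have hα1 : 0 < α - 1 := by linarith
  have hΛ0 : 0 < Λ := by rw [hΛ]; positivity
  have hΛu : Λ ≤ 1 / w ^ 4 := by
    rw [hΛ, hNα']
    rw [hNα] at hxN
    calc (α - 1) * x * (1 / (w ^ 4 * (w ^ 4 * s)))
        ≤ (1 / 1000) * (4 * (w ^ 4 * s)) * (1 / (w ^ 4 * (w ^ 4 * s))) := by
          gcongr
          linarith
      _ = (4 / 1000) * (1 / w ^ 4) := by field_simp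
      _ ≤ 1 / w ^ 4 := by linarith [show 0 < 1 / w ^ 4 by positivity]
  have hℓ : (α - 1) / 40000 / (w ^ 4 * s) ≤ Λ / 40000 := by
    rw [hΛ, hNα']
    calc (α - 1) / 40000 / (w ^ 4 * s)
        = (α - 1) * w ^ 4 * (1 / (w ^ 4 * (w ^ 4 * s))) / 40000 := by field_simp
      _ ≤ _ := by
        gcongr
        rw [hw4]
        exact hNx
  have hmain := card_near_int_of_second_diff (fun i => shiftedRoot α x ((N + i : ℕ) : ℝ)) B H D
    (δ := 1 / s) (η := 1 / w) (ℓ := Λ / 40000) (Λ := Λ) hD1 hDH (by positivity)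
    (by rw [div_le_one (by linarith)]; exact hs1) (by positivity) (by positivity)
    (by linarith) (fun m hm => by
      have hm' : N + m + 2 ≤ 8 * N := by
        have : (B + 1) * H = B * H + H := by ring
        omega
      have hm8 : (N + m + 2 : ℝ) ≤ 8 * N := by exact_mod_cast hm'
      have hm0 : (0 : ℝ) ≤ m := Nat.cast_nonneg m
      obtain ⟨ζ, hζ1, hζ2, hζ⟩ := exists_deriv_eq_second_diff (t := N + m)
        (fun t ht => hasDerivAt_shiftedRoot hα hx0.le (x := x) (by linarith))
        (fun t ht => hasDerivAt_deriv_shiftedRoot hα hx0.le (by linarith))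
      have hb := second_deriv_bounds hα (by linarith) hx0.le hN0 hxN (t := ζ) (by linarith)
        (by linarith)
      rw [← hζ] at hb
      push_cast
      simp only [← add_assoc]
      exact hb)
    (by
      calc (D : ℝ) * (2 * H * Λ) ≤ (2 * s) * (2 * (2 * w ^ 2) * (1 / w ^ 4)) := by gcongr
        _ = 8 * s / w ^ 2 := by field_simp; ring
        _ ≤ (w / 2) / w ^ 2 := by gcongr; linarith
        _ = 1 / w / 2 := by field_simp)
  have hsub := Finset.card_le_card (Finset.filter_subset_filter (fun i =>
    |shiftedRoot α x ((N + i : ℕ) : ℝ) - round (shiftedRoot α x ((N + i : ℕ) : ℝ))| ≤ 1 / s)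
    (Finset.range_subset_range.2 hBHl))
  exact (Nat.cast_le.2 hsub).trans (hmain.trans (near_integer_parameter_bound hs1 hsw hHl hHu
    hDl hDu (by positivity) hBHR hΛ0.le hΛu (by positivity) hℓ))

lemma exists_card_floorPowPairs_le_of_pos {α : ℝ} (hα : 1 < α) (hα2 : α ≤ 1 + 1 / 1000) :
    ∃ C : ℝ, 0 < C ∧ ∀ (N : ℕ) (x : ℤ), 1 ≤ N → 1 ≤ x →
      ((floorPowPairs α N x).card : ℝ) ≤ C * (N : ℝ) ^ (2 - α) := by
  have hlim := ((tendsto_rpow_atTop (show 0 < α - 1 by linarith)).comp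
    tendsto_natCast_atTop_atTop).eventually_gt_atTop (2 : ℝ)
  obtain ⟨N₁, hN₁⟩ := Filter.eventually_atTop.1 hlim
  set N₀ := max N₁ (2 ^ 32) with hN₀
  have hβ : 0 < 1 - 1 / α := by
    have : 1 / α < 1 := by rw [div_lt_one (by linarith)]; exact hα
    linarith
  have hα1 : 0 < α - 1 := by linarith
  set C₁ := 2048 / (1 - 1 / α) + 5 with hC₁
  set C₂ := 180 + 44 * (2 / ((α - 1) / 40000) + 1) with hC₂
  have hC₁0 : 0 < C₁ := by positivity
  have hC₂0 : 0 < C₂ := by positivity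
  refine ⟨C₁ + C₂ + ((N₀ : ℝ) + 1) ^ 2, by positivity, fun N x hN hx => ?_⟩
  have hN1 : (1 : ℝ) ≤ N := by exact_mod_cast hN
  have hpow : 1 ≤ (N : ℝ) ^ (2 - α) := Real.one_le_rpow hN1 (by linarith)
  have hpow0 : 0 < (N : ℝ) ^ (2 - α) := by linarith
  have hsq : 0 ≤ ((N₀ : ℝ) + 1) ^ 2 := by positivity
  rcases lt_or_ge N N₀ with hlt | hge
  · have h1 : (floorPowPairs α N x).card ≤ (N + 1) * (N + 1) := by
      refine (Finset.card_filter_le _ _).trans ?_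
      rw [Finset.card_product, Nat.card_Icc, show 2 * N + 1 - N = N + 1 by omega]
    have h2 : ((floorPowPairs α N x).card : ℝ) ≤ ((N₀ : ℝ) + 1) ^ 2 := by
      have h3 : (N : ℝ) ≤ N₀ := by exact_mod_cast hlt.le
      calc ((floorPowPairs α N x).card : ℝ) ≤ ((N : ℝ) + 1) * (N + 1) := by exact_mod_cast h1
        _ ≤ (N₀ + 1) * (N₀ + 1) := by gcongr
        _ = _ := by ring
    nlinarith
  · have hs2 : 2 < (N : ℝ) ^ (α - 1) := hN₁ N (le_of_max_le_left hge)
    have hδ : (N : ℝ) ^ (1 - α) < 1 / 2 := by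
      rw [show 1 - α = -(α - 1) by ring, Real.rpow_neg (by linarith), ← one_div]
      gcongr
    rcases (floorPowPairs α N x).eq_empty_or_nonempty with he | hne
    · rw [he, Finset.card_empty, Nat.cast_zero]
      positivity
    have hnear : ((floorPowPairs α N x).card : ℝ) ≤ _ :=
      Nat.cast_le.2 (card_floorPowPairs_le_near hα hN hx hδ)
    refine hnear.trans ?_
    rcases le_total (x : ℝ) N with hxN | hNx
    · refine (card_near_shiftedRoot_of_le hα (by linarith) hN
        (rpow_half_le_of_floorPowPairs_nonempty hα hN hx hδ hne) hxN).trans ?_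
      exact mul_le_mul_of_nonneg_right (by linarith) hpow0.le
    · refine (card_near_shiftedRoot_of_ge hα hα2 (le_of_max_le_right hge) hNx
        (le_of_floorPowPairs_nonempty hα (by linarith) hne)).trans ?_
      exact mul_le_mul_of_nonneg_right (by linarith) hpow0.le

/-- Off the diagonal, differences of `⌊m^α⌋` are equidistributed up to a constant. -/
lemma exists_card_floorPowPairs_le {α : ℝ} (hα : 1 < α) (hα2 : α ≤ 1 + 1 / 1000) :
    ∃ C : ℝ, 0 < C ∧ ∀ (N : ℕ) (x : ℤ), 1 ≤ N → x ≠ 0 →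
      ((floorPowPairs α N x).card : ℝ) ≤ C * (N : ℝ) ^ (2 - α) := by
  obtain ⟨C, hC, h⟩ := exists_card_floorPowPairs_le_of_pos hα hα2
  refine ⟨C, hC, fun N x hN hx => ?_⟩
  rcases lt_or_gt_of_ne hx with hneg | hpos
  · refine le_trans (Nat.cast_le.2 ?_) (h N (-x) hN (by omega))
    refine Finset.card_le_card_of_injOn Prod.swap (fun p hp => ?_) Prod.swap_injective.injOn
    rw [Finset.mem_coe, mem_floorPowPairs] at hp ⊢
    simp only [Prod.fst_swap, Prod.snd_swap]
    omega
  · exact h N x hN hpos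

lemma tsum_mu_mul_mu_eq (φ : ℝ → ℝ) (α : ℝ) (N : ℕ) (x : ℤ) :
    ∑' y : ℤ, mu φ α N y * mu φ α N (y - x) = ∑ p ∈ floorPowPairs α N x,
      φ ((p.1 : ℝ) / N) / p.1 * (φ ((p.2 : ℝ) / N) / p.2) := by
  rw [tsum_eq_sum (s := (Finset.Icc N (2 * N)).image fun m : ℕ => ⌊(m : ℝ) ^ α⌋)]
  · simp only [mu]
    simp_rw [Finset.sum_mul_sum]
    rw [floorPowPairs, Finset.sum_filter, Finset.sum_product, Finset.sum_comm]
    refine Finset.sum_congr rfl fun m hm => ?_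
    rw [Finset.sum_comm]
    refine Finset.sum_congr rfl fun m' _ => ?_
    rw [Finset.sum_eq_single ⌊(m : ℝ) ^ α⌋]
    · rw [if_pos rfl]
      by_cases h : ⌊(m : ℝ) ^ α⌋ - ⌊(m' : ℝ) ^ α⌋ = x
      · rw [if_pos h, if_pos (by omega)]
      · rw [if_neg h, if_neg (by omega), mul_zero]
    · intro y _ hy
      rw [if_neg hy.symm, zero_mul]
    · intro hnot
      exact absurd (Finset.mem_image_of_mem _ hm) hnot
  · intro y hy
    have : mu φ α N y = 0 := Finset.sum_eq_zero fun m hm =>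
      if_neg fun h => hy (Finset.mem_image.2 ⟨m, hm, h⟩)
    rw [this, zero_mul]

/-- Off the diagonal, `|μ_N∗μ̌_N(x)| ≤ C/N^α` for `x ≠ 0`. -/
theorem mu_autocorrelation_bound (α : ℝ) (hα₁ : 1 < α) (hα₂ : α ≤ 1 + 1 / 1000)
    (φ : ℝ → ℝ) (hφ : ContDiff ℝ (⊤ : ℕ∞) φ) (hφs : Function.support φ ⊆ Set.Ioo 1 2) :
    ∃ C : ℝ, 0 < C ∧ ∀ (n : ℕ) (x : ℤ), x ≠ 0 →
      |∑' y : ℤ, mu φ α (2 ^ n) y * mu φ α (2 ^ n) (y - x)| ≤ C / ((2 : ℝ) ^ n) ^ α := by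
  obtain ⟨C, hC, hcard⟩ := exists_card_floorPowPairs_le hα₁ hα₂
  obtain ⟨M, hM⟩ := (isCompact_Icc (a := (1 : ℝ)) (b := 2)).exists_bound_of_continuousOn
    hφ.continuous.continuousOn
  have hM0 : 0 ≤ M := (norm_nonneg _).trans (hM 1 (by norm_num))
  refine ⟨C * (M ^ 2 + 1), by positivity, fun n x hx => ?_⟩
  have hφM : ∀ t, |φ t| ≤ M := by
    intro t
    by_cases ht : t ∈ Function.support φ
    · exact hM t (Set.Ioo_subset_Icc_self (hφs ht))
    · rw [Function.notMem_support.1 ht, abs_zero]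
      exact hM0
  set N : ℕ := 2 ^ n with hN
  have hN1 : 1 ≤ N := Nat.one_le_two_pow
  have hN0 : (0 : ℝ) < N := by exact_mod_cast hN1
  have hNcast : (2 : ℝ) ^ n = N := by rw [hN]; push_cast; rfl
  have hterm : ∀ m : ℕ, N ≤ m → |φ ((m : ℝ) / N) / m| ≤ M / N := by
    intro m hm
    have hmR : (N : ℝ) ≤ m := by exact_mod_cast hm
    rw [abs_div, abs_of_pos (hN0.trans_le hmR)]
    exact div_le_div₀ hM0 (hφM _) hN0 hmR
  rw [tsum_mu_mul_mu_eq, hNcast]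
  calc |∑ p ∈ floorPowPairs α N x, φ ((p.1 : ℝ) / N) / p.1 * (φ ((p.2 : ℝ) / N) / p.2)|
      ≤ ∑ p ∈ floorPowPairs α N x, |φ ((p.1 : ℝ) / N) / p.1 * (φ ((p.2 : ℝ) / N) / p.2)| :=
        Finset.abs_sum_le_sum_abs _ _
    _ ≤ ∑ p ∈ floorPowPairs α N x, M / N * (M / N) := by
        refine Finset.sum_le_sum fun p hp => ?_
        obtain ⟨⟨⟨h1, -⟩, h2, -⟩, -⟩ := mem_floorPowPairs.1 hp
        rw [abs_mul]
        exact mul_le_mul (hterm _ h1) (hterm _ h2) (abs_nonneg _) (by positivity)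
    _ = (floorPowPairs α N x).card * (M / N * (M / N)) := by
        rw [Finset.sum_const, nsmul_eq_mul]
    _ ≤ C * (N : ℝ) ^ (2 - α) * (M / N * (M / N)) := by
        gcongr
        exact hcard N x hN1 hx
    _ = C * M ^ 2 / (N : ℝ) ^ α := by
        rw [Real.rpow_sub hN0, Real.rpow_ofNat]
        field_simp
    _ ≤ C * (M ^ 2 + 1) / (N : ℝ) ^ α := by
        gcongr
        linarith
end
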